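/- arXiv:2012.06183 — 8 statements merged into one kernel-verified Lean document; each statement's English description precedes it below -/
import Mathlib

section
/- Let K ⊆ L be finite fields with |K| = q and [L:K] = h, and let 1 ≤ k ≤ n−1. Let C ⊆ L^n be a K-subspace with dim_K C = kh and minimum Hamming distance n − k + 1 (an additive MDS code). Then the dual code C⊥ = { u ∈ L^n : Tr_{L/K}(Σ_i u_i v_i) = 0 for all v ∈ C } is a K-subspace with dim_K C⊥ = (n−k)h and minimum Hamming distance exactly k + 1; that is, C⊥ is an additive (n, q^{(n−k)h}, k+1)_{q^h} MDS code linear over K. -/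
open Module

section

variable {K L ι : Type*} [Field K] [Field L] [Algebra K L] [Fintype ι]

variable (K L ι) in
/-- The `K`-bilinear form `(u, v) ↦ Tr_{L/K} (∑ i, u i * v i)` on `ι → L`. -/
noncomputable def piTraceForm : LinearMap.BilinForm K (ι → L) :=
  ∑ i, (Algebra.traceForm K L).compl₁₂ (LinearMap.proj i) (LinearMap.proj i)

theorem piTraceForm_apply (u v : ι → L) :
    piTraceForm K L ι u v = Algebra.trace K L (∑ i, u i * v i) := by
  simp [piTraceForm, LinearMap.sum_apply, Algebra.traceForm_apply]

theorem piTraceForm_comm (u v : ι → L) : piTraceForm K L ι u v = piTraceForm K L ι v u := by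
  simp only [piTraceForm_apply, mul_comm]

theorem exists_trace_mul_ne_zero [FiniteDimensional K L] [Algebra.IsSeparable K L] {x : L}
    (hx : x ≠ 0) : ∃ y, Algebra.trace K L (x * y) ≠ 0 := by
  by_contra! h
  exact hx ((traceForm_nondegenerate K L).1 x h)

theorem piTraceForm_nondegenerate [FiniteDimensional K L] [Algebra.IsSeparable K L] :
    (piTraceForm K L ι).Nondegenerate := by
  classical
  have hleft : ∀ u, (∀ v, piTraceForm K L ι u v = 0) → u = 0 := by
    intro u hu
    by_contra! hne
    obtain ⟨i, hi⟩ := Function.ne_iff.1 hne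
    obtain ⟨y, hy⟩ := exists_trace_mul_ne_zero (K := K) hi
    refine hy ?_
    simpa [piTraceForm_apply, Pi.single_apply] using hu (Pi.single i y)
  exact ⟨hleft, fun v hv => hleft v fun u => by rw [piTraceForm_comm, hv u]⟩

/-- Restricting coordinates is onto for a code of dimension `|S| * [L : K]` with no nonzero
codeword vanishing on `S`. -/
theorem Submodule.exists_mem_forall_eq_of_finrank_eq [FiniteDimensional K L]
    {C : Submodule K (ι → L)} {S : Finset ι} (hC : finrank K C = S.card * finrank K L)
    (hS : ∀ c ∈ C, (∀ i ∈ S, c i = 0) → c = 0) (f : ι → L) :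
    ∃ c ∈ C, ∀ i ∈ S, c i = f i := by
  let φ : C →ₗ[K] (S → L) := (LinearMap.funLeft K L Subtype.val).comp C.subtype
  have hφ : Function.Injective φ := by
    refine (injective_iff_map_eq_zero φ).2 fun c hc => Subtype.ext (hS c c.2 fun i hi => ?_)
    exact congrFun hc ⟨i, hi⟩
  have hdim : finrank K C = finrank K (S → L) := by
    rw [hC, Module.finrank_pi_fintype]; simp
  obtain ⟨c, hc⟩ :=
    (LinearMap.injective_iff_surjective_of_finrank_eq_finrank hdim).1 hφ fun i => f i
  exact ⟨c, c.2, fun i hi => congrFun hc ⟨i, hi⟩⟩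

/-- A code of dimension more than `|S| * [L : K]` has a nonzero codeword vanishing on `S`. -/
theorem Submodule.exists_mem_ne_zero_of_lt_finrank [FiniteDimensional K L]
    {C : Submodule K (ι → L)} {S : Finset ι} (hC : S.card * finrank K L < finrank K C) :
    ∃ c ∈ C, c ≠ 0 ∧ ∀ i ∈ S, c i = 0 := by
  let φ : C →ₗ[K] (S → L) := (LinearMap.funLeft K L Subtype.val).comp C.subtype
  have hdim : finrank K (S → L) < finrank K C := by
    rw [Module.finrank_pi_fintype]; simpa using hC
  obtain ⟨c, hc, hne⟩ :=
    (Submodule.ne_bot_iff _).1 (LinearMap.ker_ne_bot_of_finrank_lt (f := φ) hdim)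
  exact ⟨c, c.2, fun h => hne (Subtype.ext h),
    fun i hi => congrFun (LinearMap.mem_ker.1 hc) ⟨i, hi⟩⟩

section Hamming

variable [DecidableEq L]

/-- A vector vanishing on `S` has Hamming weight at most the size of the complement of `S`. -/
theorem hammingNorm_add_card_le {u : ι → L} {S : Finset ι} (hu : ∀ i ∈ S, u i = 0) :
    hammingNorm u + S.card ≤ Fintype.card ι := by
  classical
  rw [hammingNorm, ← Finset.card_union_of_disjoint]
  · exact Finset.card_le_univ _
  · exact Finset.disjoint_left.2 fun i hi hiS => (Finset.mem_filter.1 hi).2 (hu i hiS)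

/-- If all nonzero codewords of a code of dimension `k * [L : K]` have weight more than `n - k`,
then all nonzero words of its trace dual have weight more than `k`. -/
theorem lt_hammingNorm_of_mem_orthogonal [FiniteDimensional K L] [Algebra.IsSeparable K L]
    {C : Submodule K (ι → L)} {k : ℕ} (hk : k ≤ Fintype.card ι)
    (hC : finrank K C = k * finrank K L)
    (hmin : ∀ c ∈ C, c ≠ 0 → Fintype.card ι < hammingNorm c + k)
    {w : ι → L} (hw : w ∈ (piTraceForm K L ι).orthogonal C) (hw0 : w ≠ 0) :
    k < hammingNorm w := by
  classical
  by_contra! hle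
  obtain ⟨S, hwS, -, hS⟩ := Finset.exists_subsuperset_card_eq
    (Finset.subset_univ (Finset.univ.filter fun i => w i ≠ 0)) hle hk
  obtain ⟨i, hi⟩ := Function.ne_iff.1 hw0
  obtain ⟨y, hy⟩ := exists_trace_mul_ne_zero (K := K) hi
  obtain ⟨c, hcC, hc⟩ := Submodule.exists_mem_forall_eq_of_finrank_eq (hS ▸ hC)
    (fun c hcC hc => by
      by_contra hne
      have := hammingNorm_add_card_le hc
      have := hmin c hcC hne
      omega) (Pi.single i y)
  refine hy ?_
  have hsum : ∑ j, w j * c j = w i * y := by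
    rw [Finset.sum_eq_single i _ (by simp)]
    · rw [hc i (hwS (by simpa using hi)), Pi.single_eq_same]
    · intro j _ hji
      by_cases hj : w j = 0
      · rw [hj, zero_mul]
      · rw [hc j (hwS (by simpa using hj)), Pi.single_eq_of_ne hji, mul_zero]
  rw [← hsum, ← piTraceForm_apply, piTraceForm_comm]
  exact hw c hcC

/-- The distances between distinct codewords of a linear code are the weights of its nonzero
codewords. -/
theorem setOf_hammingDist_eq_setOf_hammingNorm (C : Submodule K (ι → L)) :
    {e : ℕ | ∃ u ∈ C, ∃ v ∈ C, u ≠ v ∧ hammingDist u v = e} =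
      {e : ℕ | ∃ c ∈ C, c ≠ 0 ∧ hammingNorm c = e} := by
  ext e
  constructor
  · rintro ⟨u, hu, v, hv, huv, rfl⟩
    exact ⟨-u + v, C.add_mem (C.neg_mem hu) hv, fun h => huv (neg_add_eq_zero.1 h),
      (hammingDist_eq_hammingNorm u v).symm⟩
  · rintro ⟨c, hc, hne, rfl⟩
    exact ⟨c, hc, 0, C.zero_mem, hne, hammingDist_zero_right c⟩

end Hamming

end

/-- **The dual of an additive MDS code is MDS.**
Let `K ⊆ L` be finite fields with `|K| = q` and `[L:K] = h`, and `1 ≤ k ≤ n - 1`.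
If `C ⊆ L^n` is a `K`-subspace with `dim_K C = k * h` and minimum Hamming distance
`n - k + 1`, then the dual code
`C^⊥ = {u | Tr_{L/K}(∑ i, u i * v i) = 0 for all v ∈ C}` is a `K`-subspace of `K`-dimension
`(n - k) * h` and minimum Hamming distance exactly `k + 1`. -/
theorem dual_of_additive_MDS_code_is_MDS
    (q h k n : ℕ) (hk : 1 ≤ k) (hkn : k ≤ n - 1)
    (K L : Type*) [Field K] [Field L] [Algebra K L] [Fintype K] [Fintype L] [DecidableEq L]
    (hq : Fintype.card K = q) (hh : Module.finrank K L = h)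
    (C : Submodule K (Fin n → L)) (hCrank : Module.finrank K C = k * h)
    (hCdist : sInf {e : ℕ | ∃ u ∈ C, ∃ v ∈ C, u ≠ v ∧ hammingDist u v = e} = n - k + 1) :
    ∃ D : Submodule K (Fin n → L),
      (D : Set (Fin n → L)) =
        {u : Fin n → L | ∀ v ∈ C, Algebra.trace K L (∑ i, u i * v i) = 0} ∧
      Module.finrank K D = (n - k) * h ∧
      sInf {e : ℕ | ∃ u ∈ D, ∃ v ∈ D, u ≠ v ∧ hammingDist u v = e} = k + 1 := by
  subst hh
  have : FiniteDimensional K L := Module.Finite.of_finite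
  have hpos : 0 < finrank K L := finrank_pos
  rw [setOf_hammingDist_eq_setOf_hammingNorm] at hCdist
  have hmin : ∀ c ∈ C, c ≠ 0 → Fintype.card (Fin n) < hammingNorm c + k := by
    intro c hc hne
    have := hCdist.symm.trans_le (Nat.sInf_le ⟨c, hc, hne, rfl⟩)
    rw [Fintype.card_fin]
    omega
  have hrank : finrank K ((piTraceForm K L (Fin n)).orthogonal C) = (n - k) * finrank K L := by
    rw [LinearMap.BilinForm.finrank_orthogonal piTraceForm_nondegenerate, hCrank,
      Module.finrank_pi_fintype, Nat.sub_mul]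
    simp
  refine ⟨(piTraceForm K L (Fin n)).orthogonal C, ?_, hrank, ?_⟩
  · ext u
    simp only [SetLike.mem_coe, LinearMap.BilinForm.mem_orthogonal_iff, Set.mem_ofPred_eq,
      ← piTraceForm_apply]
    exact forall₂_congr fun v _ => by rw [piTraceForm_comm u v]
  rw [setOf_hammingDist_eq_setOf_hammingNorm]
  have hlow : ∀ w ∈ (piTraceForm K L (Fin n)).orthogonal C, w ≠ 0 → k + 1 ≤ hammingNorm w :=
    fun w hw hw0 => lt_hammingNorm_of_mem_orthogonal (by rw [Fintype.card_fin]; omega)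
      hCrank hmin hw hw0
  obtain ⟨S, -, hS⟩ := Finset.exists_subset_card_eq (s := (Finset.univ : Finset (Fin n)))
    (n := n - k - 1) (by rw [Finset.card_univ, Fintype.card_fin]; omega)
  obtain ⟨w, hw, hw0, hwS⟩ := Submodule.exists_mem_ne_zero_of_lt_finrank (S := S)
    (by rw [hrank, hS]; exact Nat.mul_lt_mul_of_pos_right (by omega) hpos)
  have hwle := hammingNorm_add_card_le hwS
  rw [Fintype.card_fin] at hwle
  have hwk : hammingNorm w = k + 1 := le_antisymm (by omega) (hlow w hw hw0)
  refine IsLeast.csInf_eq ⟨⟨w, hw, hw0, hwk⟩, ?_⟩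
  rintro _ ⟨c, hc, hc0, rfl⟩
  exact hlow c hc hc0
end

section
/- Let K be a finite field, let V be a K-vector space of dimension kh, and let X be a finite set of h-dimensional subspaces of V with |X| ≥ k such that any k distinct elements of X together span V. Let A ⊆ X with |A| = r ≤ k − 2, and let U = Σ_{W ∈ A} W. Then under the quotient map π : V → V/U, the image π(W) of every W ∈ X \ A is an h-dimensional subspace of V/U, and any k − r distinct elements of X \ A have images that together span V/U (which has dimension (k−r)h). In other words, the projection of X \ A from U is an arc of (h−1)-spaces in PG((k−r)h − 1, q). -/
/-- The span of finitely many `h`-dimensional subspaces has dimension at most `h` times their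
number. -/
theorem finrank_finset_sup_le_card_mul {K V : Type*} [Field K] [AddCommGroup V] [Module K V]
    [FiniteDimensional K V] {h : ℕ} (S : Finset (Submodule K V))
    (hS : ∀ W ∈ S, Module.finrank K W = h) :
    Module.finrank K (S.sup id : Submodule K V) ≤ S.card * h := by
  classical
  induction S using Finset.induction_on with
  | empty => simp
  | insert W S hW ih =>
    rw [Finset.sup_insert, Finset.card_insert_of_notMem hW]
    have h₁ := Submodule.finrank_add_le_finrank_add_finrank W (S.sup id)
    have h₂ := ih fun W' hW' => hS W' (Finset.mem_insert_of_mem hW')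
    have h₃ := hS W (Finset.mem_insert_self W S)
    simp only [id] at *
    linarith

/-- At most `k` elements of an arc of `h`-dimensional subspaces are independent. -/
theorem finrank_finset_sup_eq_card_mul_of_arc {K V : Type*} [Field K] [AddCommGroup V]
    [Module K V] [FiniteDimensional K V] {k h : ℕ} (hV : Module.finrank K V = k * h)
    {X : Finset (Submodule K V)} (hdim : ∀ W ∈ X, Module.finrank K W = h)
    (hcard : k ≤ X.card) (harc : ∀ Y ⊆ X, Y.card = k → Y.sup id = ⊤)
    {S : Finset (Submodule K V)} (hS : S ⊆ X) (hSk : S.card ≤ k) :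
    Module.finrank K (S.sup id : Submodule K V) = S.card * h := by
  classical
  refine le_antisymm (finrank_finset_sup_le_card_mul S fun W hW => hdim W (hS hW)) ?_
  obtain ⟨Y, hSY, hYX, hY⟩ := Finset.exists_subsuperset_card_eq hS hSk hcard
  have hsup : S.sup id ⊔ (Y \ S).sup id = ⊤ := by
    rw [← Finset.sup_union, Finset.union_sdiff_of_subset hSY, harc Y hYX hY]
  have h₁ := Submodule.finrank_add_le_finrank_add_finrank (S.sup id) ((Y \ S).sup id)
  rw [hsup, finrank_top, hV] at h₁
  have h₂ := finrank_finset_sup_le_card_mul (Y \ S)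
    fun W hW => hdim W (hYX (Finset.sdiff_subset hW))
  have h₃ : (Y \ S).card + S.card = k := by rw [Finset.card_sdiff_add_card_eq_card hSY, hY]
  rw [← h₃, add_mul] at h₁
  linarith

/-- A subspace disjoint from `U` keeps its dimension in the quotient by `U`. -/
theorem finrank_map_mkQ_of_disjoint {K V : Type*} [Field K] [AddCommGroup V] [Module K V]
    {U W : Submodule K V} (hUW : Disjoint W U) :
    Module.finrank K (W.map U.mkQ) = Module.finrank K W := by
  rw [← LinearMap.range_domRestrict]
  refine LinearMap.finrank_range_of_inj ?_
  rw [← LinearMap.ker_eq_bot, LinearMap.ker_domRestrict, Submodule.ker_mkQ]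
  exact Submodule.disjoint_iff_comap_eq_bot.mp hUW


/-- **The projection lemma for arcs of `(h-1)`-spaces.**
Let `K` be a finite field, `V` a `K`-vector space of dimension `k * h`, and `X` a finite set of
`h`-dimensional subspaces of `V` with `|X| ≥ k` such that any `k` distinct elements of `X` span
`V`.  Let `A ⊆ X` with `|A| = r ≤ k - 2` and `U = Σ_{W ∈ A} W`.  Then under the quotient map
`V → V ⧸ U`, every `W ∈ X \ A` maps onto an `h`-dimensional subspace, `V ⧸ U` has dimension
`(k - r) * h`, and any `k - r` distinct elements of `X \ A` have images spanning `V ⧸ U`. -/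
theorem projection_of_arc_is_arc
    (k h r : ℕ) (K : Type*) [Field K] [Fintype K]
    (V : Type*) [AddCommGroup V] [Module K V] [FiniteDimensional K V]
    [DecidableEq (Submodule K V)]
    (hV : Module.finrank K V = k * h)
    (X : Finset (Submodule K V))
    (hdim : ∀ W ∈ X, Module.finrank K W = h)
    (hcard : k ≤ X.card)
    (harc : ∀ Y ⊆ X, Y.card = k → Y.sup id = ⊤)
    (A : Finset (Submodule K V)) (hA : A ⊆ X) (hAr : A.card = r) (hr : r ≤ k - 2) :
    (∀ W ∈ X \ A, Module.finrank K (W.map (A.sup id).mkQ) = h) ∧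
    Module.finrank K (V ⧸ A.sup id) = (k - r) * h ∧
    ∀ Y ⊆ X \ A, Y.card = k - r →
      (Y.sup fun W => W.map (A.sup id).mkQ) = ⊤ := by
  have hrk : r ≤ k := hr.trans (Nat.sub_le k 2)
  have hU : Module.finrank K (A.sup id : Submodule K V) = r * h := by
    rw [← hAr]
    exact finrank_finset_sup_eq_card_mul_of_arc hV hdim hcard harc hA (hAr.trans_le hrk)
  refine ⟨fun W hW => ?_, ?_, fun Y hY hYcard => ?_⟩
  · obtain ⟨hWX, hWA⟩ := Finset.mem_sdiff.mp hW
    rw [finrank_map_mkQ_of_disjoint, hdim W hWX]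
    rcases Nat.eq_zero_or_pos r with rfl | hr₀
    · rw [Finset.card_eq_zero.mp hAr]
      exact disjoint_bot_right
    · have hins : (insert W A).card = r + 1 := by rw [Finset.card_insert_of_notMem hWA, hAr]
      have h₁ := finrank_finset_sup_eq_card_mul_of_arc hV hdim hcard harc
        (Finset.insert_subset hWX hA) (by omega)
      rw [hins, Finset.sup_insert, id] at h₁
      have h₂ := Submodule.finrank_sup_add_finrank_inf_eq W (A.sup id)
      rw [h₁, hdim W hWX, hU] at h₂
      rw [disjoint_iff, ← Submodule.finrank_eq_zero (R := K)]
      linarith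
  · have h₁ := Submodule.finrank_quotient_add_finrank (A.sup id)
    rw [hU, hV] at h₁
    rw [Nat.sub_mul]
    omega
  · have hdisj : Disjoint Y A := Finset.disjoint_of_subset_left hY Finset.sdiff_disjoint
    have hsup := harc (Y ∪ A) (Finset.union_subset (hY.trans Finset.sdiff_subset) hA)
      (by rw [Finset.card_union_of_disjoint hdisj]; omega)
    rw [Finset.sup_union] at hsup
    have hmap : (Y.sup id).map (A.sup id).mkQ = Y.sup fun W => W.map (A.sup id).mkQ :=
      Finset.apply_sup_eq_sup_comp (Submodule.map (A.sup id).mkQ)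
        (fun _ _ => Submodule.map_sup _ _ _) (Submodule.map_bot _)
    rw [← hmap, Submodule.map_mkQ_eq_top, sup_comm, hsup]
end

section
/- Let K = F_q and V = K^2 × K^2. Let S be a set of 2 × 2 matrices over K containing the zero matrix O and the identity matrix I, such that the subspaces π_A = { (x, Ax) : x ∈ K^2 } for A ∈ S, together with π_∞ = {0} × K^2, pairwise intersect trivially, and suppose all of these subspaces are contained in a Desarguesian spread of V: that is, there exist a field L with K ⊆ L and [L:K] = 2, and a K-algebra homomorphism φ : L → End_K(V), such that π_∞ and every π_A (A ∈ S) are invariant under φ(λ) for all λ ∈ L. Then there exist a_1, a_2 ∈ K such that the polynomial X² + a_2 X − a_1 is irreducible over K and every A ∈ S has the form A = [[x_1, a_1 x_2], [x_2, x_1 + a_2 x_2]] for some x_1, x_2 ∈ K. -/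
/-- The subspace `π_A = {(x, A x)}` of `K² × K²` associated to a `2 × 2` matrix `A`. -/
def graphSubspace {K : Type*} [Field K] (A : Matrix (Fin 2) (Fin 2) K) :
    Submodule K ((Fin 2 → K) × (Fin 2 → K)) :=
  LinearMap.graph A.mulVecLin

/-- The subspace `π_∞ = {0} × K²` of `K² × K²`. -/
def piInfty (K : Type*) [Field K] : Submodule K ((Fin 2 → K) × (Fin 2 → K)) :=
  (⊥ : Submodule K (Fin 2 → K)).prod ⊤

open Polynomial in
/-- If a `2 × 2` matrix has no eigenvalue in `K`, then its lower left entry is nonzero and the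
quadratic attached to its normalisation `[[0, a₁], [1, a₂]]` is irreducible. -/
theorem irreducible_quadratic_of_det_sub_scalar_ne_zero {K : Type*} [Field K]
    (B : Matrix (Fin 2) (Fin 2) K)
    (hB : ∀ c : K, (B - Matrix.scalar (Fin 2) c).det ≠ 0) :
    B 1 0 ≠ 0 ∧
      Irreducible (X ^ 2 + C ((B 1 1 - B 0 0) / B 1 0) * X - C (B 0 1 / B 1 0)) := by
  have h10 : B 1 0 ≠ 0 := by
    intro h
    apply hB (B 0 0)
    simp [Matrix.det_fin_two, h]
  refine ⟨h10, ?_⟩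
  set a₁ := B 0 1 / B 1 0 with ha₁
  set a₂ := (B 1 1 - B 0 0) / B 1 0 with ha₂
  have hdeg : (X ^ 2 + C a₂ * X - C a₁).natDegree = 2 := by compute_degree!
  rw [irreducible_iff_roots_eq_zero_of_degree_le_three (by omega) (by omega)]
  rw [Multiset.eq_zero_iff_forall_notMem]
  intro r hr
  have hroot : r ^ 2 + a₂ * r - a₁ = 0 := by
    simpa [IsRoot] using isRoot_of_mem_roots hr
  apply hB (B 0 0 - B 1 0 * r)
  have h01 : B 0 1 = a₁ * B 1 0 := by rw [ha₁]; field_simp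
  have h11 : B 1 1 = B 0 0 + a₂ * B 1 0 := by rw [ha₂]; field_simp; ring
  simp only [Matrix.det_fin_two, Matrix.sub_apply, Matrix.scalar_apply, Matrix.diagonal_apply_eq,
    ne_eq, zero_ne_one, one_ne_zero, not_false_eq_true, Matrix.diagonal_apply_ne, h01, h11]
  linear_combination (B 1 0) ^ 2 * hroot

/-- A matrix commuting with `B` has the form `x₁ + x₂ M`, where `M = [[0, a₁], [1, a₂]]` is the
normalisation of `B`. -/
theorem eq_of_commute_of_lowerLeft_ne_zero {K : Type*} [Field K]
    {A B : Matrix (Fin 2) (Fin 2) K} (h10 : B 1 0 ≠ 0) (hAB : Commute A B) :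
    A = !![A 0 0, B 0 1 / B 1 0 * A 1 0;
      A 1 0, A 0 0 + (B 1 1 - B 0 0) / B 1 0 * A 1 0] := by
  have h00 := congrFun (congrFun hAB.eq 0) 0
  have hlow := congrFun (congrFun hAB.eq 1) 0
  simp only [Matrix.mul_apply, Fin.sum_univ_two] at h00 hlow
  ext i j
  fin_cases i <;> fin_cases j <;> simp
  · field_simp
    linear_combination h00
  · field_simp
    linear_combination hlow

theorem mem_graphSubspace {K : Type*} [Field K] {A : Matrix (Fin 2) (Fin 2) K}
    {v : (Fin 2 → K) × (Fin 2 → K)} : v ∈ graphSubspace A ↔ v.2 = A.mulVec v.1 := by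
  simp [graphSubspace, LinearMap.mem_graph_iff]

theorem mem_piInfty {K : Type*} [Field K] {v : (Fin 2 → K) × (Fin 2 → K)} :
    v ∈ piInfty K ↔ v.1 = 0 := by
  simp [piInfty, Submodule.mem_prod]

/-- An endomorphism of `K² × K²` leaving `π_∞`, `π_O` and `π_I` invariant is `B × B` for some
matrix `B`. -/
theorem exists_matrix_of_invariant {K : Type*} [Field K]
    (f : Module.End K ((Fin 2 → K) × (Fin 2 → K)))
    (hinf : ∀ v ∈ piInfty K, f v ∈ piInfty K)
    (h0 : ∀ v ∈ graphSubspace (0 : Matrix (Fin 2) (Fin 2) K), f v ∈ graphSubspace 0)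
    (h1 : ∀ v ∈ graphSubspace (1 : Matrix (Fin 2) (Fin 2) K), f v ∈ graphSubspace 1) :
    ∃ B : Matrix (Fin 2) (Fin 2) K, ∀ x y, f (x, y) = (B.mulVec x, B.mulVec y) := by
  simp only [mem_graphSubspace, mem_piInfty, Matrix.zero_mulVec, Matrix.one_mulVec] at hinf h0 h1
  let g := LinearMap.fst K _ _ ∘ₗ f ∘ₗ LinearMap.inl K (Fin 2 → K) (Fin 2 → K)
  have hg : ∀ x, (LinearMap.toMatrix' g).mulVec x = (f (x, 0)).1 := fun x => by
    rw [LinearMap.toMatrix'_mulVec]; rfl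
  have hadd : ∀ x y, f (x, y) = f (x, 0) + f (0, y) := fun x y => by
    rw [← map_add]; simp
  refine ⟨LinearMap.toMatrix' g, fun x y => ?_⟩
  have hy := h1 (y, y) rfl
  have hx0 := h0 (x, 0) rfl
  have hy0 := h0 (y, 0) rfl
  have hx := hinf (0, x) rfl
  have hy' := hinf (0, y) rfl
  rw [hadd] at hy
  rw [hadd, hg, hg]
  ext1
  · simp [hy']
  · simpa [hx0, hy0, hy'] using hy

/-- **Spread sets of Desarguesian spreads containing `O` and `I`.**
Let `K = F_q` and let `S` be a set of `2 × 2` matrices over `K` containing `0` and `1`, whose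
graphs `π_A` together with `π_∞` pairwise intersect trivially, all contained in a Desarguesian
spread of `V = K² × K²` (i.e. invariant under a `K`-algebra action of a quadratic extension `L`
of `K` on `V`).  Then there are `a₁, a₂ ∈ K` with `X² + a₂X − a₁` irreducible over `K` such
that every `A ∈ S` has the form `[[x₁, a₁x₂], [x₂, x₁ + a₂x₂]]`. -/
theorem desarguesian_spread_set_form
    (q : ℕ) (K : Type*) [Field K] [Fintype K] (hq : Fintype.card K = q)
    (S : Set (Matrix (Fin 2) (Fin 2) K))
    (hS0 : (0 : Matrix (Fin 2) (Fin 2) K) ∈ S)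
    (hS1 : (1 : Matrix (Fin 2) (Fin 2) K) ∈ S)
    (hspread : ∀ A ∈ S, ∀ B ∈ S, A ≠ B → graphSubspace A ⊓ graphSubspace B = ⊥)
    (hspreadinf : ∀ A ∈ S, graphSubspace A ⊓ piInfty K = ⊥)
    (L : Type*) [Field L] [Algebra K L] (hL : Module.finrank K L = 2)
    (φ : L →ₐ[K] Module.End K ((Fin 2 → K) × (Fin 2 → K)))
    (hinvinf : ∀ l : L, ∀ v ∈ piInfty K, φ l v ∈ piInfty K)
    (hinv : ∀ A ∈ S, ∀ l : L, ∀ v ∈ graphSubspace A, φ l v ∈ graphSubspace A) :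
    ∃ a₁ a₂ : K,
      Irreducible (Polynomial.X ^ 2 + Polynomial.C a₂ * Polynomial.X - Polynomial.C a₁) ∧
      ∀ A ∈ S, ∃ x₁ x₂ : K, A = !![x₁, a₁ * x₂; x₂, x₁ + a₂ * x₂] := by
  have hlt : ∃ l : L, l ∉ (⊥ : Subalgebra K L) := by
    by_contra! h
    have htop : (⊥ : Subalgebra K L) = ⊤ := by
      ext l
      simp [h l]
    have := Subalgebra.bot_eq_top_iff_finrank_eq_one.mp htop
    omega
  obtain ⟨l, hl⟩ := hlt
  obtain ⟨B, hB⟩ := exists_matrix_of_invariant (φ l) (hinvinf l) (hinv 0 hS0 l) (hinv 1 hS1 l)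
  have hdet : ∀ c : K, (B - Matrix.scalar (Fin 2) c).det ≠ 0 := by
    intro c hc
    obtain ⟨x, hx, hBx⟩ := Matrix.exists_mulVec_eq_zero_iff.mpr hc
    have hlc : l - algebraMap K L c ≠ 0 := fun h =>
      hl (Algebra.mem_bot.mpr ⟨c, (sub_eq_zero.mp h).symm⟩)
    have hzero : φ (l - algebraMap K L c) (x, 0) = 0 := by
      rw [map_sub, AlgHom.commutes, LinearMap.sub_apply, hB, Module.algebraMap_end_apply]
      rw [Matrix.sub_mulVec] at hBx
      ext1
      · simpa [Matrix.scalar_apply, ← Matrix.smul_one_eq_diagonal, Matrix.smul_mulVec] using hBx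
      · simp
    have hinvl : φ (l - algebraMap K L c)⁻¹ (φ (l - algebraMap K L c) (x, 0)) = (x, 0) := by
      rw [← Module.End.mul_apply, ← map_mul, inv_mul_cancel₀ hlc, map_one, Module.End.one_apply]
    rw [hzero, map_zero] at hinvl
    exact hx (congrArg Prod.fst hinvl).symm
  obtain ⟨h10, hirr⟩ := irreducible_quadratic_of_det_sub_scalar_ne_zero B hdet
  refine ⟨_, _, hirr, fun A hA => ⟨A 0 0, A 1 0, eq_of_commute_of_lowerLeft_ne_zero h10 ?_⟩⟩
  apply Matrix.ext_of_mulVec_single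
  intro i
  have h := hinv A hA l (Pi.single i 1, A.mulVec (Pi.single i 1)) (mem_graphSubspace.mpr rfl)
  rw [hB, mem_graphSubspace] at h
  simpa only [Matrix.mulVec_mulVec] using h.symm
end

section
/- The MDS conjecture holds for additive codes over F_9: if C ⊆ F_9^n is a nonempty subset closed under componentwise addition (equivalently an F_3-subspace of F_9^n) with |C| = 9^k, 2 ≤ k ≤ n − 2, and minimum Hamming distance n − k + 1, then n ≤ 10. -/
namespace AdditiveMDS

open Finset Matrix

/-! ### Arithmetic of `2 × 2` matrices over `ZMod 3`, encoded by natural numbers below `81` -/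

/-- The `2 × 2` matrices over `ZMod 3`. -/
abbrev Mat : Type := Matrix (Fin 2) (Fin 2) (ZMod 3)

/-- The number with the given four ternary digits. -/
def code (a b c d : ℕ) : ℕ := a % 3 + 3 * (b % 3) + 9 * (c % 3) + 27 * (d % 3)

/-- The base `3` encoding of a matrix. -/
def enc (A : Mat) : ℕ := code (A 0 0).val (A 0 1).val (A 1 0).val (A 1 1).val

/-- Subtraction of encoded matrices. -/
def codeSub (x y : ℕ) : ℕ :=
  code (x % 3 + 2 * (y % 3)) (x / 3 % 3 + 2 * (y / 3 % 3))
    (x / 9 % 3 + 2 * (y / 9 % 3)) (x / 27 % 3 + 2 * (y / 27 % 3))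

/-- Multiplication of encoded matrices. -/
def codeMul (x y : ℕ) : ℕ :=
  code ((x % 3) * (y % 3) + (x / 3 % 3) * (y / 9 % 3))
    ((x % 3) * (y / 3 % 3) + (x / 3 % 3) * (y / 27 % 3))
    ((x / 9 % 3) * (y % 3) + (x / 27 % 3) * (y / 9 % 3))
    ((x / 9 % 3) * (y / 3 % 3) + (x / 27 % 3) * (y / 27 % 3))

/-- The determinant of an encoded matrix. -/
def codeDet (x : ℕ) : ℕ := ((x % 3) * (x / 27 % 3) + 2 * ((x / 3 % 3) * (x / 9 % 3))) % 3

/-- The inverse of an encoded matrix. -/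
def codeInv (x : ℕ) : ℕ :=
  code (codeDet x * (x / 27 % 3)) (2 * (codeDet x * (x / 3 % 3)))
    (2 * (codeDet x * (x / 9 % 3))) (codeDet x * (x % 3))

/-- The encoding of `X⁻¹ * Y`. -/
def codeQuo (x y : ℕ) : ℕ := codeMul (codeInv x) y

/-- Bit `81 * x + y` says whether the difference of the matrices encoded by `x` and `y` is
invertible. -/
def ndTable : ℕ :=
  2750776737526063327360411641387068956108065346665664077759453245531647290358508677227060122340015186507278056185122250492711597559421602435750789511122862138898344175061646548116725555588529305129544014326235291087175612611053891780119074093997571416495349121750421741861258654745325057400484411337190281216751622855738409288489132937019101647166189965633775454103785748032118191909884667507920796949349611833409903995261831024843861004517441676256437576905677596402859760031779891435917806140170932270143803937963969575109479126417656928620867264868585409519793991559634150371763651603618543068460760476398393129377189441758859955135211937566465329055148075026973782387035952943600788767507395404251258510034225013252033690276011706915312481603903647185029931933127418096900355454636117669239423817882334949028490510408105494891834049488225688488248264207733091248318901392844670459163121271150012421434285036021673013975908659716459067301385567779409035480380046391000970506447058031965825213621188276880890532916266253638786954806596999614943664299084165759673051607706329021487975808960950896976516323291319451806919855874952874277962458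359973998784698045958220511391558757216839677484798518361630608222710543056742699988863554811000660769476467932538634491831084335758033275615901483499902719868638096731208855387448709115461825737283542564540080865692474514964960116018139392761760890958630496809332890396237633711800891209202663354709963955596637418629571631174248088879666439807273395943076325661686814391745151465713670119607791677899410416442163354534609782191097158527122630246244134314923635674915684748082822612317932323388646171955820261030895650998051948880907526463762262189961795594164685060483808103457020477886054556445493397600159113303497647477806285433546003665674727706774009700753010245633700736772265857352580142528721263287005511165953200971072983645657522177923353422844296923020491559946932104952391974578103362897027698332912685894702136029184

/-- Nondegeneracy of the difference of two encoded matrices, by table lookup. -/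
def nd (x y : ℕ) : Bool :=
  Nat.beq (Nat.land 1 (Nat.shiftRight ndTable (Nat.add (Nat.mul 81 x) y))) 1

theorem nd_eq : ∀ x < 81, ∀ y < 81, nd x y = !Nat.beq (codeDet (codeSub x y)) 0 := by
  decide +kernel

theorem code_mod (a b c d : ℕ) : code a b c d % 3 = a % 3 := by unfold code; omega

theorem code_div_three (a b c d : ℕ) : code a b c d / 3 % 3 = b % 3 := by unfold code; omega

theorem code_div_nine (a b c d : ℕ) : code a b c d / 9 % 3 = c % 3 := by unfold code; omega

theorem code_div_twentySeven (a b c d : ℕ) : code a b c d / 27 % 3 = d % 3 := by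
  unfold code; omega

theorem code_lt (a b c d : ℕ) : code a b c d < 81 := by unfold code; omega

theorem code_congr {a b c d a' b' c' d' : ℕ} (ha : a % 3 = a' % 3) (hb : b % 3 = b' % 3)
    (hc : c % 3 = c' % 3) (hd : d % 3 = d' % 3) : code a b c d = code a' b' c' d' := by
  simp only [code, ha, hb, hc, hd]

theorem enc_lt (A : Mat) : enc A < 81 := code_lt _ _ _ _

theorem val_mod (a : ZMod 3) : a.val % 3 = a.val := Nat.mod_eq_of_lt a.val_lt

theorem enc_injective : Function.Injective enc := by
  intro A B h
  have h0 := congrArg (· % 3) h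
  have h1 := congrArg (· / 3 % 3) h
  have h2 := congrArg (· / 9 % 3) h
  have h3 := congrArg (· / 27 % 3) h
  simp only [enc, code_mod, code_div_three, code_div_nine, code_div_twentySeven, val_mod]
    at h0 h1 h2 h3
  ext i j
  fin_cases i <;> fin_cases j
  · exact ZMod.val_injective 3 h0
  · exact ZMod.val_injective 3 h1
  · exact ZMod.val_injective 3 h2
  · exact ZMod.val_injective 3 h3

theorem val_sub_eq : ∀ a b : ZMod 3, (a - b).val = (a.val + 2 * b.val) % 3 := by decide

theorem val_mul_add_mul : ∀ a b c d : ZMod 3,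
    (a * b + c * d).val = (a.val * b.val + c.val * d.val) % 3 := by decide

theorem val_mul_sub_mul : ∀ a b c d : ZMod 3,
    (a * d - b * c).val = (a.val * d.val + 2 * (b.val * c.val)) % 3 := by decide

theorem val_mul_eq : ∀ a b : ZMod 3, (a * b).val = a.val * b.val % 3 := by decide

theorem val_neg_mul_eq : ∀ a b : ZMod 3, (-(a * b)).val = 2 * (a.val * b.val) % 3 := by decide

theorem enc_sub (A B : Mat) : enc (A - B) = codeSub (enc A) (enc B) := by
  simp only [codeSub, enc, code_mod, code_div_three, code_div_nine, code_div_twentySeven, val_mod]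
  apply code_congr <;> simp [val_sub_eq]

theorem enc_mul (A B : Mat) : enc (A * B) = codeMul (enc A) (enc B) := by
  simp only [codeMul, enc, code_mod, code_div_three, code_div_nine, code_div_twentySeven, val_mod]
  apply code_congr <;> simp [Matrix.mul_apply, val_mul_add_mul]

theorem codeDet_enc (A : Mat) : codeDet (enc A) = A.det.val := by
  simp only [codeDet, enc, code_mod, code_div_three, code_div_nine, code_div_twentySeven, val_mod,
    Matrix.det_fin_two, val_mul_sub_mul]

theorem enc_inv (A : Mat) : enc A⁻¹ = codeInv (enc A) := by
  have hinv (a : ZMod 3) : a⁻¹ = a := by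
    have hsq : ∀ a : ZMod 3, a = 0 ∨ a * a = 1 := by decide
    obtain rfl | h := hsq a
    · exact inv_zero
    · exact inv_eq_of_mul_eq_one_left h
  simp only [codeInv, codeDet_enc]
  simp only [enc, code_mod, code_div_three, code_div_nine, code_div_twentySeven, val_mod,
    Matrix.inv_def, Ring.inverse_eq_inv', hinv, Matrix.adjugate_fin_two]
  apply code_congr <;> simp [val_mul_eq, val_neg_mul_eq]

theorem enc_inv_mul (A B : Mat) : enc (A⁻¹ * B) = codeQuo (enc A) (enc B) := by
  rw [enc_mul, enc_inv, codeQuo]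

theorem nd_enc (A B : Mat) : nd (enc A) (enc B) = true ↔ (A - B).det ≠ 0 := by
  rw [nd_eq _ (enc_lt A) _ (enc_lt B), ← enc_sub, codeDet_enc, Bool.not_eq_true',
    ← Bool.not_eq_true, Nat.beq_eq, ZMod.val_eq_zero]

theorem enc_zero : enc 0 = 0 := by decide

theorem enc_one : enc 1 = 28 := by decide

theorem exists_enc_eq : ∀ x < 81, ∃ A : Mat, enc A = x := by
  intro x hx
  refine ⟨!![(x : ZMod 3), ((x / 3 : ℕ) : ZMod 3);
    ((x / 9 : ℕ) : ZMod 3), ((x / 27 : ℕ) : ZMod 3)], ?_⟩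
  simp [enc, code, ZMod.val_natCast]
  omega

/-! ### The exhaustive search -/

/-- An encoded row `(1, A, B)` of a three column array, together with the two quotients
`A⁻¹ * B` and `(A - 1)⁻¹ * (B - 1)`. -/
structure Pt where
  a : ℕ
  b : ℕ
  c : ℕ
  d : ℕ

/-- The codes of the matrices `A` for which `A` and `A - 1` are invertible. -/
def units : List ℕ := (List.range 81).filter fun x => nd x 0 && nd x 28

/-- Representatives of `units` up to conjugation. -/
def reps : List ℕ := [13, 14, 15, 16, 56]

/-- The encoded rows `(1, A, B)` that can occur next to the row `(1, 1, 1)`. -/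
def points : List Pt :=
  units.flatMap fun a => (units.filter (nd a)).map fun b =>
    ⟨a, b, codeQuo a b, codeQuo (codeSub a 28) (codeSub b 28)⟩

/-- The code of `(A_q - A_p)⁻¹ * (B_q - B_p)`, where `p` and `q` encode `(1, A_p, B_p)` and
`(1, A_q, B_q)`. -/
def slope (p q : Pt) : ℕ := codeQuo (codeSub q.a p.a) (codeSub q.b p.b)

/-- The code of `B⁻¹ * (B - 1) * ((A - 1)⁻¹ * A)`. -/
def param (p : Pt) : ℕ := codeMul (codeQuo p.b (codeSub p.b 28)) (codeQuo (codeSub p.a 28) p.a)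

/-- Conjunction, not evaluating the second argument when the first is `false`. -/
def conj (a b : Bool) : Bool := Bool.rec false b a

/-- All minors of order at most two formed from the rows `p` and `q` are nondegenerate, also after
subtracting the row `(1, 1, 1)`. -/
def compat (p q : Pt) : Bool :=
  conj (nd p.a q.a) (conj (nd p.b q.b) (conj (nd p.c q.c) (nd p.d q.d)))

/-- Evaluate a number before passing it on. -/
def force {α : Type} (n : ℕ) (k : ℕ → α) : α := Nat.rec (k 0) (fun m _ => k (Nat.succ m)) n

/-- Evaluate a list of points before passing it on, in reverse order. -/
def forcePoints {β : Type} (l : List Pt) (k : List Pt → β) : β :=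
  List.rec (motive := fun _ => List Pt → β) (fun acc => k acc)
    (fun p _ ih acc => force p.a fun a => force p.b fun b => force p.c fun c => force p.d fun d =>
      ih (⟨a, b, c, d⟩ :: acc)) l []

/-- Filter a list, evaluating it before passing it on, in reverse order. -/
def filterThen {β : Type} (f : Pt → Bool) (l : List Pt) (k : List Pt → β) : β :=
  List.rec (motive := fun _ => List Pt → β) (fun acc => k acc)
    (fun h _ ih acc => Bool.rec (ih acc) (ih (h :: acc)) (f h)) l []

/-- Whether all points of a list satisfy `f`. -/
def allOf (f : Pt → Bool) (l : List Pt) : Bool := List.rec true (fun h _ ih => conj (f h) ih) l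

/-- No five rows with pairwise and triplewise nondegenerate position, the first one having its
first entry in `reps`, contain two rows with different parameters. -/
def search : Bool :=
  forcePoints points fun pts =>
  allOf (fun p => Bool.rec true (
    filterThen (compat p) pts fun nbrs =>
    force (param p) fun t =>
    allOf (fun q => Bool.rec (
      filterThen (fun r => conj (compat q r) (nd (slope p q) (slope p r))) nbrs fun l =>
      allOf (fun r =>
        filterThen (fun s => conj (compat r s) (conj (nd (slope p r) (slope p s))
          (nd (slope q r) (slope q s)))) l fun m =>
        allOf (fun s => allOf (fun u =>
          Bool.rec true (Bool.rec true false (nd (slope p s) (slope p u))) (compat s u)) m) m) l)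
      true (Nat.beq t (param q))) nbrs) (reps.elem p.a)) pts

theorem search_eq_true : search = true := by decide +kernel

theorem reps_check : ∀ x ∈ units, ∃ p < 81, nd p 0 = true ∧
    codeMul (codeMul p x) (codeInv p) ∈ reps := by
  decide +kernel

theorem conj_eq (a b : Bool) : conj a b = (a && b) := by cases a <;> rfl

theorem force_eq {α : Type} (n : ℕ) (k : ℕ → α) : force n k = k n := by cases n <;> rfl

theorem forcePoints_eq {β : Type} (l : List Pt) (k : List Pt → β) :
    forcePoints l k = k l.reverse := by
  suffices h : ∀ acc, List.rec (motive := fun _ => List Pt → β) (fun acc => k acc)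
      (fun p _ ih acc => force p.a fun a => force p.b fun b => force p.c fun c =>
        force p.d fun d => ih (⟨a, b, c, d⟩ :: acc)) l acc = k (l.reverse ++ acc) by
    simpa [forcePoints] using h []
  induction l with
  | nil => intro acc; rfl
  | cons p l ih =>
    intro acc
    have h := ih (p :: acc)
    simp only [force_eq] at h ⊢
    rw [h]; simp

theorem filterThen_eq {β : Type} (f : Pt → Bool) (l : List Pt) (k : List Pt → β) :
    filterThen f l k = k (l.filter f).reverse := by
  suffices h : ∀ acc, List.rec (motive := fun _ => List Pt → β) (fun acc => k acc)
      (fun h _ ih acc => Bool.rec (ih acc) (ih (h :: acc)) (f h)) l acc =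
        k ((l.filter f).reverse ++ acc) by
    simpa [filterThen] using h []
  induction l with
  | nil => intro acc; rfl
  | cons p l ih =>
    intro acc
    cases hp : f p
    · simp only [hp]; rw [ih]; simp [hp]
    · simp only [hp]; rw [ih]; simp [hp]

theorem allOf_eq_true (f : Pt → Bool) (l : List Pt) :
    allOf f l = true ↔ ∀ p ∈ l, f p = true := by
  induction l with
  | nil => simp [allOf]
  | cons p l ih =>
    have : allOf f (p :: l) = conj (f p) (allOf f l) := rfl
    simp [this, conj_eq, ih]

theorem boolRec_eq_true (a b c : Bool) :
    (Bool.rec a b c : Bool) = true ↔ (c = false → a = true) ∧ (c = true → b = true) := by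
  cases c <;> simp

theorem search_sound {p q r s u : Pt} (hp : p ∈ points) (hq : q ∈ points) (hr : r ∈ points)
    (hs : s ∈ points) (hu : u ∈ points) (hrep : p.a ∈ reps) (hpq : compat p q = true)
    (hpr : compat p r = true) (hps : compat p s = true) (hpu : compat p u = true)
    (hqr : compat q r = true) (hqs : compat q s = true) (hqu : compat q u = true)
    (hrs : compat r s = true) (hru : compat r u = true) (hsu : compat s u = true)
    (hpqr : nd (slope p q) (slope p r) = true) (hpqs : nd (slope p q) (slope p s) = true)
    (hpqu : nd (slope p q) (slope p u) = true) (hprs : nd (slope p r) (slope p s) = true)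
    (hpru : nd (slope p r) (slope p u) = true) (hpsu : nd (slope p s) (slope p u) = true)
    (hqrs : nd (slope q r) (slope q s) = true) (hqru : nd (slope q r) (slope q u) = true) :
    param p = param q := by
  by_contra hne
  have h := search_eq_true
  simp only [search, forcePoints_eq, filterThen_eq, force_eq, allOf_eq_true, conj_eq,
    boolRec_eq_true, List.mem_reverse, List.mem_filter, Bool.and_eq_true, List.elem_eq_mem,
    decide_eq_true_eq] at h
  have hbeq : Nat.beq (param p) (param q) = false := by
    rw [← Bool.not_eq_true, Nat.beq_eq]; exact hne
  have := (((((h p hp).2 hrep q ⟨hq, hpq⟩).1 hbeq r ⟨⟨hr, hpr⟩, hqr, hpqr⟩) s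
    ⟨⟨⟨hs, hps⟩, hqs, hpqs⟩, hrs, hprs, hqrs⟩ u
    ⟨⟨⟨hu, hpu⟩, hqu, hpqu⟩, hru, hpru, hqru⟩).2 hsu).2 hpsu
  simp at this

/-! ### Three column arrays of matrices -/

/-- Every minor of order at most three of the block array with rows `(1, A i, B i)` that involves
the first column, as well as every entry, is nondegenerate. -/
structure IsArc {ι : Type*} (A B : ι → Mat) : Prop where
  det_left : ∀ i, (A i).det ≠ 0
  det_right : ∀ i, (B i).det ≠ 0
  left_sub : ∀ i j, i ≠ j → (A i - A j).det ≠ 0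
  right_sub : ∀ i j, i ≠ j → (B i - B j).det ≠ 0
  right_sub_left : ∀ i j, i ≠ j → ((A i)⁻¹ * B i - (A j)⁻¹ * B j).det ≠ 0
  slope_sub : ∀ i j k, i ≠ j → i ≠ k → j ≠ k →
    ((A j - A i)⁻¹ * (B j - B i) - (A k - A i)⁻¹ * (B k - B i)).det ≠ 0

theorem IsArc.conj {ι : Type*} {A B : ι → Mat} (h : IsArc A B) {P : Mat} (hP : P.det ≠ 0) :
    IsArc (fun i => P * A i * P⁻¹) (fun i => P * B i * P⁻¹) := by
  have hu : IsUnit P.det := hP.isUnit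
  have hinv (X : Mat) : (P * X * P⁻¹)⁻¹ = P * X⁻¹ * P⁻¹ := by
    rw [Matrix.mul_inv_rev, Matrix.mul_inv_rev, Matrix.nonsing_inv_nonsing_inv _ hu, mul_assoc]
  have hmul (X Y : Mat) : P * X * P⁻¹ * (P * Y * P⁻¹) = P * (X * Y) * P⁻¹ := by
    simp only [mul_assoc, Matrix.nonsing_inv_mul_cancel_left _ _ hu]
  have hsub (X Y : Mat) : P * X * P⁻¹ - P * Y * P⁻¹ = P * (X - Y) * P⁻¹ := by
    rw [mul_sub, sub_mul]
  have hdet (X : Mat) : (P * X * P⁻¹).det = X.det := by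
    rw [Matrix.det_mul, Matrix.det_mul, mul_right_comm, ← Matrix.det_mul,
      Matrix.mul_nonsing_inv _ hu, Matrix.det_one, one_mul]
  constructor <;> simp only [hinv, hmul, hsub, hdet]
  exacts [h.det_left, h.det_right, h.left_sub, h.right_sub, h.right_sub_left, h.slope_sub]

/-- The encoding of the row `(1, A, B)`. -/
noncomputable def encPt (A B : Mat) : Pt :=
  ⟨enc A, enc B, enc (A⁻¹ * B), enc ((A - 1)⁻¹ * (B - 1))⟩

theorem param_encPt (A B : Mat) :
    param (encPt A B) = enc (B⁻¹ * (B - 1) * ((A - 1)⁻¹ * A)) := by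
  rw [enc_mul, enc_inv_mul, enc_inv_mul, enc_sub, enc_sub, enc_one]
  rfl

theorem slope_encPt (A B A' B' : Mat) :
    slope (encPt A B) (encPt A' B') = enc ((A' - A)⁻¹ * (B' - B)) := by
  rw [enc_inv_mul, enc_sub, enc_sub]
  rfl

theorem enc_mem_units {A : Mat} (h0 : A.det ≠ 0) (h1 : (A - 1).det ≠ 0) : enc A ∈ units := by
  rw [units, List.mem_filter, List.mem_range, ← enc_zero, ← enc_one, Bool.and_eq_true, nd_enc,
    nd_enc, sub_zero]
  exact ⟨enc_lt A, h0, h1⟩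

theorem encPt_mem_points {A B : Mat} (hA : A.det ≠ 0) (hB : B.det ≠ 0) (hA1 : (A - 1).det ≠ 0)
    (hB1 : (B - 1).det ≠ 0) (hAB : (A - B).det ≠ 0) : encPt A B ∈ points := by
  refine List.mem_flatMap.2 ⟨enc A, enc_mem_units hA hA1, List.mem_map.2 ⟨enc B,
    List.mem_filter.2 ⟨enc_mem_units hB hB1, (nd_enc A B).2 hAB⟩, ?_⟩⟩
  rw [encPt, enc_inv_mul, enc_inv_mul, enc_sub, enc_sub, enc_one]

/-- A matrix `A` with `A` and `A - 1` invertible is conjugate to one encoded in `reps`. -/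
theorem exists_conj_mem_reps {A : Mat} (h0 : A.det ≠ 0) (h1 : (A - 1).det ≠ 0) :
    ∃ P : Mat, P.det ≠ 0 ∧ enc (P * A * P⁻¹) ∈ reps := by
  obtain ⟨p, hp, hp0, hrep⟩ := reps_check _ (enc_mem_units h0 h1)
  obtain ⟨P, rfl⟩ := exists_enc_eq p hp
  rw [← enc_zero, nd_enc, sub_zero] at hp0
  refine ⟨P, hp0, ?_⟩
  rwa [enc_mul, enc_mul, enc_inv]

theorem IsArc.param_eq_of_mem_reps {ι : Type*} [Fintype ι] {A B : ι → Mat} (h : IsArc A B) {o : ι}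
    (hAo : A o = 1) (hBo : B o = 1) (hcard : 6 ≤ Fintype.card ι) {i j : ι} (hi : i ≠ o)
    (hj : j ≠ o) (hij : i ≠ j) (hrep : enc (A i) ∈ reps) :
    (B i)⁻¹ * (B i - 1) * ((A i - 1)⁻¹ * A i) = (B j)⁻¹ * (B j - 1) * ((A j - 1)⁻¹ * A j) := by
  classical
  have hthree : 3 ≤ #(univ \ {o, i, j} : Finset ι) := by
    have := le_card_sdiff ({o, i, j} : Finset ι) univ
    have := card_le_three (a := o) (b := i) (c := j)
    rw [card_univ] at *
    omega
  obtain ⟨t, ht, htc⟩ := exists_subset_card_eq hthree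
  obtain ⟨k, l, m, hkl, hkm, hlm, rfl⟩ := card_eq_three.1 htc
  simp only [insert_subset_iff, singleton_subset_iff, mem_sdiff, mem_univ, true_and, mem_insert,
    mem_singleton, not_or, ← ne_eq] at ht
  obtain ⟨⟨hko, hki, hkj⟩, ⟨hlo, hli, hlj⟩, hmo, hmi, hmj⟩ := ht
  have mem {x : ι} (hx : x ≠ o) : encPt (A x) (B x) ∈ points := by
    refine encPt_mem_points (h.det_left x) (h.det_right x) ?_ ?_ ?_
    · simpa [hAo] using h.left_sub x o hx
    · simpa [hBo] using h.right_sub x o hx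
    · have h1 := h.right_sub_left x o hx
      have h2 : A x - B x = -(A x * ((A x)⁻¹ * B x - (A o)⁻¹ * B o)) := by
        rw [hAo, hBo, mul_sub, Matrix.mul_nonsing_inv_cancel_left _ _ (h.det_left x).isUnit]
        simp
      rw [h2, Matrix.det_neg, Matrix.det_mul]
      simpa using ⟨h.det_left x, h1⟩
  have comp {x y : ι} (hx : x ≠ o) (hy : y ≠ o) (hxy : x ≠ y) :
      compat (encPt (A x) (B x)) (encPt (A y) (B y)) = true := by
    simp only [compat, conj_eq, Bool.and_eq_true, encPt, nd_enc]
    refine ⟨h.left_sub x y hxy, h.right_sub x y hxy, h.right_sub_left x y hxy, ?_⟩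
    simpa [hAo, hBo] using h.slope_sub o x y hx.symm hy.symm hxy
  have slp {x y z : ι} (hxy : x ≠ y) (hxz : x ≠ z) (hyz : y ≠ z) :
      nd (slope (encPt (A x) (B x)) (encPt (A y) (B y)))
        (slope (encPt (A x) (B x)) (encPt (A z) (B z))) = true := by
    rw [slope_encPt, slope_encPt, nd_enc]
    exact h.slope_sub x y z hxy hxz hyz
  apply enc_injective
  rw [← param_encPt, ← param_encPt]
  exact search_sound (mem hi) (mem hj) (mem hko) (mem hlo) (mem hmo) hrep
    (comp hi hj hij) (comp hi hko hki.symm) (comp hi hlo hli.symm) (comp hi hmo hmi.symm)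
    (comp hj hko hkj.symm) (comp hj hlo hlj.symm) (comp hj hmo hmj.symm) (comp hko hlo hkl)
    (comp hko hmo hkm) (comp hlo hmo hlm) (slp hij hki.symm hkj.symm) (slp hij hli.symm hlj.symm)
    (slp hij hmi.symm hmj.symm) (slp hki.symm hli.symm hkl) (slp hki.symm hmi.symm hkm)
    (slp hli.symm hmi.symm hlm) (slp hkj.symm hlj.symm hkl) (slp hkj.symm hmj.symm hkm)

/-- The rows of an arc with at least six rows, normalized at the row `o`, satisfy
`(B i)⁻¹ - 1 = T * ((A i)⁻¹ - 1)` for a common `T`. -/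
theorem IsArc.param_eq {ι : Type*} [Fintype ι] {A B : ι → Mat} (h : IsArc A B) {o : ι}
    (hAo : A o = 1) (hBo : B o = 1) (hcard : 6 ≤ Fintype.card ι) {i j : ι} (hi : i ≠ o)
    (hj : j ≠ o) :
    (B i)⁻¹ * (B i - 1) * ((A i - 1)⁻¹ * A i) = (B j)⁻¹ * (B j - 1) * ((A j - 1)⁻¹ * A j) := by
  obtain rfl | hij := eq_or_ne i j
  · rfl
  have hA1 : (A i - 1).det ≠ 0 := by simpa [hAo] using h.left_sub i o hi
  obtain ⟨P, hP, hrep⟩ := exists_conj_mem_reps (h.det_left i) hA1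
  have hu : IsUnit P.det := hP.isUnit
  have hone : P * 1 * P⁻¹ = 1 := by rw [mul_one, Matrix.mul_nonsing_inv _ hu]
  have key := (h.conj hP).param_eq_of_mem_reps (o := o) (by rw [hAo, hone]) (by rw [hBo, hone])
    hcard hi hj hij hrep
  have hconj (X Y : Mat) : (P * Y * P⁻¹)⁻¹ * (P * Y * P⁻¹ - 1) *
      ((P * X * P⁻¹ - 1)⁻¹ * (P * X * P⁻¹)) = P * (Y⁻¹ * (Y - 1) * ((X - 1)⁻¹ * X)) * P⁻¹ := by
    have hsub (Z : Mat) : P * Z * P⁻¹ - 1 = P * (Z - 1) * P⁻¹ := by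
      rw [mul_sub, sub_mul, hone]
    rw [hsub, hsub]
    simp only [Matrix.mul_inv_rev, Matrix.nonsing_inv_nonsing_inv _ hu, mul_assoc,
      Matrix.nonsing_inv_mul_cancel_left _ _ hu]
  simp only [hconj] at key
  have := congrArg (fun X => P⁻¹ * X * P) key
  simpa only [mul_assoc, Matrix.nonsing_inv_mul_cancel_left _ _ hu, Matrix.nonsing_inv_mul _ hu,
    mul_one] using this

/-! ### Superregular block matrices -/

section Superregular

variable {ι κ : Type*} [Fintype κ]

/-- The action of a block matrix on a block vector. -/
def app (G : ι → κ → Mat) (x : κ → Fin 2 → ZMod 3) (i : ι) : Fin 2 → ZMod 3 :=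
  ∑ j, G i j *ᵥ x j

theorem app_single_add [DecidableEq κ] (G : ι → κ → Mat) (a b c : κ) (u v w : Fin 2 → ZMod 3)
    (i : ι) : app G (Pi.single a u + Pi.single b v + Pi.single c w) i =
      G i a *ᵥ u + G i b *ᵥ v + G i c *ᵥ w := by
  have h (a : κ) (u : Fin 2 → ZMod 3) : ∑ j, G i j *ᵥ (Pi.single a u : κ → _) j = G i a *ᵥ u := by
    rw [Fintype.sum_eq_single a]
    · simp
    · intro j hj
      simp [hj]
  simp only [app, Pi.add_apply, Matrix.mulVec_add, sum_add_distrib, h]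

variable [Fintype ι]

/-- A block matrix is superregular if the graph of its action is an MDS code: the support of a
nonzero vector is larger than the zero set of its image. -/
def Superregular (G : ι → κ → Mat) : Prop :=
  ∀ x : κ → Fin 2 → ZMod 3, x ≠ 0 → #{i | app G x i = 0} < #{j | x j ≠ 0}

theorem Superregular.eq_zero {G : ι → κ → Mat} (hG : Superregular G) {x : κ → Fin 2 → ZMod 3}
    {s : Finset κ} {t : Finset ι} (hst : #s ≤ #t) (hs : ∀ j, x j ≠ 0 → j ∈ s)
    (ht : ∀ i ∈ t, app G x i = 0) : x = 0 := by
  classical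
  by_contra hx
  have h1 := hG x hx
  have h2 : #{j | x j ≠ 0} ≤ #s := card_le_card fun j hj => hs j (mem_filter.1 hj).2
  have h3 : #t ≤ #{i | app G x i = 0} := card_le_card fun i hi => by simp [ht i hi]
  omega

theorem Superregular.scale {G : ι → κ → Mat} (hG : Superregular G) {P : ι → Mat} {Q : κ → Mat}
    (hP : ∀ i, (P i).det ≠ 0) (hQ : ∀ j, (Q j).det ≠ 0) :
    Superregular fun i j => P i * G i j * Q j := by
  have hinj {M : Mat} (hM : M.det ≠ 0) (v : Fin 2 → ZMod 3) : M *ᵥ v = 0 ↔ v = 0 :=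
    ⟨fun h => Matrix.eq_zero_of_mulVec_eq_zero hM h, fun h => by simp [h]⟩
  intro x hx
  have happ (i : ι) : app (fun i j => P i * G i j * Q j) x i =
      P i *ᵥ app G (fun j => Q j *ᵥ x j) i := by
    simp only [app, Matrix.mulVec_sum, Matrix.mulVec_mulVec, mul_assoc]
  have hne : (fun j => Q j *ᵥ x j) ≠ 0 := by
    refine fun h => hx (funext fun j => ?_)
    exact (hinj (hQ j) _).1 (congrFun h j)
  simpa only [happ, hinj (hP _), ne_eq, hinj (hQ _)] using hG _ hne

theorem Superregular.eq_zero_of_three {G : ι → κ → Mat} (hG : Superregular G) {a b c : κ}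
    (hac : a ≠ c) (hbc : b ≠ c) {i j k : ι} (hij : i ≠ j) (hik : i ≠ k)
    (hjk : j ≠ k) {u v w : Fin 2 → ZMod 3} (hi : G i a *ᵥ u + G i b *ᵥ v + G i c *ᵥ w = 0)
    (hj : G j a *ᵥ u + G j b *ᵥ v + G j c *ᵥ w = 0)
    (hk : G k a *ᵥ u + G k b *ᵥ v + G k c *ᵥ w = 0) : w = 0 := by
  classical
  have h := hG.eq_zero (x := Pi.single a u + Pi.single b v + Pi.single c w) (s := {a, b, c})
    (t := {i, j, k}) ?_ ?_ ?_
  · simpa [hac, hbc, Pi.single_apply, hac.symm, hbc.symm] using congrFun h c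
  · rw [card_eq_three.2 ⟨i, j, k, hij, hik, hjk, rfl⟩]
    exact card_le_three
  · intro l hl
    contrapose! hl
    simp only [mem_insert, mem_singleton, not_or] at hl
    simp [hl]
  · intro l hl
    simp only [mem_insert, mem_singleton] at hl
    rw [app_single_add]
    obtain rfl | rfl | rfl := hl
    exacts [hi, hj, hk]

theorem Superregular.eq_zero_of_two {G : ι → κ → Mat} (hG : Superregular G) {a b : κ}
    (hab : a ≠ b) {i j : ι} (hij : i ≠ j) {u v : Fin 2 → ZMod 3}
    (hi : G i a *ᵥ u + G i b *ᵥ v = 0) (hj : G j a *ᵥ u + G j b *ᵥ v = 0) : v = 0 := by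
  classical
  have h := hG.eq_zero (x := Pi.single a u + Pi.single b v + Pi.single b 0) (s := {a, b})
    (t := {i, j}) ?_ ?_ ?_
  · simpa [hab, hab.symm, Pi.single_apply] using congrFun h b
  · rw [card_pair hij]
    exact card_le_two
  · intro l hl
    contrapose! hl
    simp only [mem_insert, mem_singleton, not_or] at hl
    simp [hl]
  · intro l hl
    simp only [mem_insert, mem_singleton] at hl
    rw [app_single_add, Matrix.mulVec_zero, add_zero]
    obtain rfl | rfl := hl
    exacts [hi, hj]

theorem det_ne_zero_of_mulVec {M : Mat} (h : ∀ v, M *ᵥ v = 0 → v = 0) : M.det ≠ 0 := by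
  intro hM
  obtain ⟨v, hv, hMv⟩ := Matrix.exists_mulVec_eq_zero_iff.2 hM
  exact hv (h v hMv)

theorem Superregular.det_ne_zero {G : ι → κ → Mat} (hG : Superregular G) (i : ι) (j : κ) :
    (G i j).det ≠ 0 := by
  classical
  refine det_ne_zero_of_mulVec fun v hv => ?_
  have h := hG.eq_zero (x := Pi.single j v + Pi.single j 0 + Pi.single j 0) (s := {j})
    (t := {i}) le_rfl ?_ ?_
  · simpa using congrFun h j
  · intro l hl
    contrapose! hl
    simp only [mem_singleton] at hl
    simp [hl]
  · intro l hl
    rw [mem_singleton.1 hl, app_single_add, hv]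
    simp only [Matrix.mulVec_zero, add_zero]

theorem Superregular.sub_det_ne_zero {G : ι → κ → Mat} (hG : Superregular G) {a b : κ}
    (hone : ∀ i, G i a = 1) (hab : a ≠ b) {i j : ι} (hij : i ≠ j) :
    (G i b - G j b).det ≠ 0 := by
  refine det_ne_zero_of_mulVec fun v hv => ?_
  rw [Matrix.sub_mulVec, sub_eq_zero] at hv
  refine hG.eq_zero_of_two hab hij (u := -(G i b *ᵥ v)) (v := v) ?_ ?_
  · simp [hone]
  · simp [hone, hv]

theorem Superregular.isArc {G : ι → κ → Mat} (hG : Superregular G) {a b c : κ}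
    (hone : ∀ i, G i a = 1) (hab : a ≠ b) (hac : a ≠ c) (hbc : b ≠ c) :
    IsArc (fun i => G i b) (fun i => G i c) where
  det_left i := hG.det_ne_zero i b
  det_right i := hG.det_ne_zero i c
  left_sub i j hij := hG.sub_det_ne_zero hone hab hij
  right_sub i j hij := hG.sub_det_ne_zero hone hac hij
  right_sub_left i j hij := by
    refine det_ne_zero_of_mulVec fun v hv => ?_
    rw [Matrix.sub_mulVec, sub_eq_zero] at hv
    refine hG.eq_zero_of_two hbc hij (u := -(((G i b)⁻¹ * G i c) *ᵥ v)) (v := v) ?_ ?_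
    · rw [Matrix.mulVec_neg, Matrix.mulVec_mulVec,
        Matrix.mul_nonsing_inv_cancel_left _ _ (hG.det_ne_zero i b).isUnit, neg_add_cancel]
    · rw [hv, Matrix.mulVec_neg, Matrix.mulVec_mulVec,
        Matrix.mul_nonsing_inv_cancel_left _ _ (hG.det_ne_zero j b).isUnit, neg_add_cancel]
  slope_sub i j k hij hik hjk := by
    refine det_ne_zero_of_mulVec fun v hv => ?_
    rw [Matrix.sub_mulVec, sub_eq_zero] at hv
    set u := ((G j b - G i b)⁻¹ * (G j c - G i c)) *ᵥ v with hu
    have h1 : (G j b - G i b) *ᵥ u = (G j c - G i c) *ᵥ v := by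
      rw [hu, Matrix.mulVec_mulVec, Matrix.mul_nonsing_inv_cancel_left _ _
        (hG.sub_det_ne_zero hone hab hij.symm).isUnit]
    have h2 : (G k b - G i b) *ᵥ u = (G k c - G i c) *ᵥ v := by
      rw [hv, Matrix.mulVec_mulVec, Matrix.mul_nonsing_inv_cancel_left _ _
        (hG.sub_det_ne_zero hone hab hik.symm).isUnit]
    rw [Matrix.sub_mulVec, Matrix.sub_mulVec] at h1 h2
    refine hG.eq_zero_of_three hac hbc hij hik hjk (u := G i b *ᵥ u - G i c *ᵥ v) (v := -u)
      (w := v) ?_ ?_ ?_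
    · simp only [hone, Matrix.one_mulVec, Matrix.mulVec_neg]
      abel
    · simp only [hone, Matrix.one_mulVec, Matrix.mulVec_neg]
      linear_combination -h1
    · simp only [hone, Matrix.one_mulVec, Matrix.mulVec_neg]
      linear_combination -h2

/-- Rows and columns of a superregular matrix can be scaled so that a given row and a given column
consist of identity matrices. -/
theorem Superregular.exists_normalized {G : ι → κ → Mat} (hG : Superregular G) (o : ι) (a : κ) :
    ∃ G' : ι → κ → Mat, Superregular G' ∧ (∀ i, G' i a = 1) ∧ ∀ j, G' o j = 1 := by
  have hP (i : ι) : (G i a)⁻¹.det ≠ 0 :=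
    (Matrix.isUnit_nonsing_inv_det _ (hG.det_ne_zero i a).isUnit).ne_zero
  have hQ (j : κ) : ((G o a)⁻¹ * G o j).det ≠ 0 := by
    rw [Matrix.det_mul]
    exact mul_ne_zero (hP o) (hG.det_ne_zero o j)
  refine ⟨_, hG.scale hP fun j =>
    (Matrix.isUnit_nonsing_inv_det _ (hQ j).isUnit).ne_zero, fun i => ?_, fun j => ?_⟩
  · simp only [Matrix.nonsing_inv_mul _ (hG.det_ne_zero i a).isUnit,
      Matrix.nonsing_inv_mul _ (hG.det_ne_zero o a).isUnit, inv_one, mul_one]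
  · exact Matrix.mul_nonsing_inv _ (hQ j).isUnit

end Superregular

theorem card_nonzero_vectors : Fintype.card {v : Fin 2 → ZMod 3 // v ≠ 0} = 8 := by
  rw [Fintype.card_subtype_compl, Fintype.card_subtype_eq]
  simp [ZMod.card]

theorem mulVec_ne_zero {M : Mat} (hM : M.det ≠ 0) {v : Fin 2 → ZMod 3} (hv : v ≠ 0) :
    M *ᵥ v ≠ 0 := fun h => hv (Matrix.eq_zero_of_mulVec_eq_zero hM h)

theorem inv_det_ne_zero {M : Mat} (hM : M.det ≠ 0) : M⁻¹.det ≠ 0 :=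
  (Matrix.isUnit_nonsing_inv_det _ hM.isUnit).ne_zero

theorem inv_sub_inv_det_ne_zero {M N : Mat} (hM : M.det ≠ 0) (hN : N.det ≠ 0)
    (h : (M - N).det ≠ 0) : (M⁻¹ - N⁻¹).det ≠ 0 := by
  have : M⁻¹ - N⁻¹ = -(M⁻¹ * (M - N) * N⁻¹) := by
    rw [mul_sub, sub_mul, Matrix.nonsing_inv_mul _ hM.isUnit, one_mul,
      Matrix.mul_nonsing_inv_cancel_right _ _ hN.isUnit, neg_sub]
  rw [this, Matrix.det_neg, Matrix.det_mul, Matrix.det_mul]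
  exact mul_ne_zero (pow_ne_zero _ (by decide))
    (mul_ne_zero (mul_ne_zero (inv_det_ne_zero hM) h) (inv_det_ne_zero hN))

/-- The matrix `T` with `B⁻¹ - 1 = T * (A⁻¹ - 1)`. -/
theorem param_mul {A B : Mat} (hA : A.det ≠ 0) (hB : B.det ≠ 0) (hA1 : (A - 1).det ≠ 0) :
    B⁻¹ * (B - 1) * ((A - 1)⁻¹ * A) * (A⁻¹ - 1) = B⁻¹ - 1 := by
  have h1 : A * (A⁻¹ - 1) = -(A - 1) := by
    rw [mul_sub, Matrix.mul_nonsing_inv _ hA.isUnit, mul_one, neg_sub]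
  rw [mul_assoc, mul_assoc _ A, h1, mul_neg, Matrix.nonsing_inv_mul _ hA1.isUnit, mul_neg, mul_one,
    mul_sub, Matrix.nonsing_inv_mul _ hB.isUnit, mul_one, neg_sub]

section Bound

variable {ι κ : Type*} [Fintype ι] [Fintype κ]

/-- In a normalized superregular matrix with at least six rows, the columns are parametrized by
matrices `T c` relative to a fixed column `b`. -/
theorem Superregular.exists_param {G : ι → κ → Mat} (hG : Superregular G) {o : ι} {a b : κ}
    (hcol : ∀ i, G i a = 1) (hrow : ∀ j, G o j = 1) (hab : a ≠ b) (hcard : 6 ≤ Fintype.card ι) :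
    ∃ T : κ → Mat, ∀ c, c ≠ a → c ≠ b → (T c).det ≠ 0 ∧
      ∀ i, T c * ((G i b)⁻¹ - 1) = (G i c)⁻¹ - 1 := by
  have : Nontrivial ι := Fintype.one_lt_card_iff_nontrivial.1 (by omega)
  obtain ⟨i₀, hi₀⟩ := exists_ne o
  have hsub {c : κ} (hc : a ≠ c) {i : ι} (hi : i ≠ o) : (G i c - 1).det ≠ 0 := by
    simpa [hrow] using hG.sub_det_ne_zero hcol hc hi
  refine ⟨fun c => (G i₀ c)⁻¹ * (G i₀ c - 1) * ((G i₀ b - 1)⁻¹ * G i₀ b), fun c hca hcb =>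
    ⟨?_, fun i => ?_⟩⟩
  · simp only [Matrix.det_mul]
    exact mul_ne_zero (mul_ne_zero (inv_det_ne_zero (hG.det_ne_zero _ _)) (hsub hca.symm hi₀))
      (mul_ne_zero (inv_det_ne_zero (hsub hab hi₀)) (hG.det_ne_zero _ _))
  · obtain rfl | hi := eq_or_ne i o
    · simp [hrow]
    · have h := (hG.isArc hcol hab hca.symm hcb.symm).param_eq (hrow b) (hrow c) hcard hi₀ hi
      simp only [h]
      exact param_mul (hG.det_ne_zero _ _) (hG.det_ne_zero _ _) (hsub hab hi)

theorem Superregular.card_add_card_le_of_six_le {G : ι → κ → Mat} (hG : Superregular G)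
    (hι : 6 ≤ Fintype.card ι) (hκ : 2 ≤ Fintype.card κ) :
    Fintype.card ι + Fintype.card κ ≤ 10 := by
  classical
  have : Nonempty ι := Fintype.card_pos_iff.1 (by omega)
  have : Nontrivial ι := Fintype.one_lt_card_iff_nontrivial.1 (by omega)
  have o : ι := Classical.arbitrary ι
  obtain ⟨a, b, hab⟩ := Fintype.one_lt_card_iff.1 (show 1 < Fintype.card κ by omega)
  obtain ⟨G, hG, hcol, hrow⟩ := hG.exists_normalized o a
  obtain ⟨T, hT⟩ := hG.exists_param hcol hrow hab hι
  obtain ⟨i₀, hi₀⟩ := exists_ne o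
  have hinj {c : κ} (hc : a ≠ c) {i j : ι} (hij : i ≠ j) : ((G i c)⁻¹ - (G j c)⁻¹).det ≠ 0 :=
    inv_sub_inv_det_ne_zero (hG.det_ne_zero _ _) (hG.det_ne_zero _ _)
      (hG.sub_det_ne_zero hcol hc hij)
  have hinj' {b c : κ} (hb : a ≠ b) (hc : a ≠ c) (hbc : b ≠ c) {i : ι} (hi : i ≠ o) :
      ((G i b)⁻¹ - (G i c)⁻¹).det ≠ 0 := by
    refine inv_sub_inv_det_ne_zero (hG.det_ne_zero _ _) (hG.det_ne_zero _ _) ?_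
    refine det_ne_zero_of_mulVec fun v hv => ?_
    rw [Matrix.sub_mulVec, sub_eq_zero] at hv
    refine hG.eq_zero_of_two hbc hi (u := -v) (v := v) ?_ ?_
    · rw [Matrix.mulVec_neg, hv, neg_add_cancel]
    · rw [hrow, hrow, Matrix.mulVec_neg, neg_add_cancel]
  let e : Fin 2 → ZMod 3 := ![1, 0]
  have he : e ≠ 0 := by decide
  have key (c : {c : κ // c ≠ a ∧ c ≠ b}) : ∃ u : Fin 2 → ZMod 3, T c *ᵥ u = -e := by
    refine ⟨(T c)⁻¹ *ᵥ (-e), ?_⟩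
    rw [Matrix.mulVec_mulVec, Matrix.mul_nonsing_inv _ (hT c c.2.1 c.2.2).1.isUnit,
      Matrix.one_mulVec]
  choose u hu using key
  have hTsub (c : {c : κ // c ≠ a ∧ c ≠ b}) (i : ι) :
      T c * ((G i b)⁻¹ - 1) = (G i c)⁻¹ - 1 := (hT c c.2.1 c.2.2).2 i
  have hb1 : ((G i₀ b)⁻¹ - 1).det ≠ 0 := by simpa [hrow] using hinj hab hi₀
  have hw (c : {c : κ // c ≠ a ∧ c ≠ b}) : e + u c ≠ 0 := by
    intro h
    have hTe : (T c - 1).det ≠ 0 := by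
      have h1 : (T c - 1) * ((G i₀ b)⁻¹ - 1) = (G i₀ c)⁻¹ - (G i₀ b)⁻¹ := by
        rw [sub_mul, hTsub, one_mul, sub_sub_sub_cancel_right]
      have h2 := hinj' c.2.1.symm hab c.2.2 hi₀
      rw [← h1, Matrix.det_mul] at h2
      exact left_ne_zero_of_mul h2
    refine mulVec_ne_zero hTe he ?_
    have h3 := hu c
    rw [eq_neg_of_add_eq_zero_right h, Matrix.mulVec_neg, neg_inj] at h3
    rw [Matrix.sub_mulVec, h3, Matrix.one_mulVec, sub_self]
  have hx (i : ι) : (G i b)⁻¹ *ᵥ e ≠ 0 := mulVec_ne_zero (inv_det_ne_zero (hG.det_ne_zero _ _)) he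
  let f : ι ⊕ {c : κ // c ≠ a ∧ c ≠ b} → {v : Fin 2 → ZMod 3 // v ≠ 0} :=
    Sum.elim (fun i => ⟨(G i b)⁻¹ *ᵥ e, hx i⟩) (fun c => ⟨e + u c, hw c⟩)
  have hf : Function.Injective f := by
    refine Function.Injective.sumElim ?_ ?_ ?_
    · intro i j hij
      by_contra hne
      refine mulVec_ne_zero (hinj hab hne) he ?_
      rw [Matrix.sub_mulVec, sub_eq_zero]
      exact congrArg Subtype.val hij
    · intro c d hcd
      by_contra hne
      have hucd : u c = u d := add_left_cancel (congrArg Subtype.val hcd)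
      have hTe : (T c - T d).det ≠ 0 := by
        have h1 : (T c - T d) * ((G i₀ b)⁻¹ - 1) = (G i₀ c)⁻¹ - (G i₀ d)⁻¹ := by
          rw [sub_mul, hTsub, hTsub, sub_sub_sub_cancel_right]
        have h2 := hinj' c.2.1.symm d.2.1.symm (fun h => hne (Subtype.ext h)) hi₀
        rw [← h1, Matrix.det_mul] at h2
        exact left_ne_zero_of_mul h2
      have hu0 : u c ≠ 0 := by
        intro h
        have h3 := hu c
        rw [h, Matrix.mulVec_zero, eq_comm, neg_eq_zero] at h3
        exact he h3
      refine mulVec_ne_zero hTe hu0 ?_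
      rw [Matrix.sub_mulVec, hu c, hucd, hu d, sub_self]
    · intro i c hic
      have h1 : (G i b)⁻¹ *ᵥ e = e + u c := congrArg Subtype.val hic
      have h2 : ((G i b)⁻¹ - 1) *ᵥ e = u c := by
        rw [Matrix.sub_mulVec, h1, Matrix.one_mulVec, add_sub_cancel_left]
      have h3 : ((G i c)⁻¹ - 1) *ᵥ e = -e := by
        rw [← hTsub, ← Matrix.mulVec_mulVec, h2, hu]
      rw [Matrix.sub_mulVec, Matrix.one_mulVec, sub_eq_neg_self] at h3
      exact mulVec_ne_zero (inv_det_ne_zero (hG.det_ne_zero i c)) he h3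
  have hle := Fintype.card_le_of_injective f hf
  have hsub : Fintype.card {c : κ // c ≠ a ∧ c ≠ b} + 2 = Fintype.card κ := by
    have h1 := card_sdiff_add_card_eq_card (subset_univ ({a, b} : Finset κ))
    rw [card_pair hab, card_univ] at h1
    rw [← h1, Fintype.card_subtype]
    congr 2
    ext c
    simp
  rw [Fintype.card_sum, card_nonzero_vectors] at hle
  omega

/-- The transpose of a superregular matrix is superregular. -/
theorem Superregular.transpose {G : ι → κ → Mat} (hG : Superregular G) :
    Superregular fun j i => (G i j)ᵀ := by
  classical
  intro y hy
  by_contra! hle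
  obtain ⟨t, ht, htc⟩ := exists_subset_card_eq hle
  set s : Finset ι := {i | y i ≠ 0} with hs
  let ext (z : t → Fin 2 → ZMod 3) (j : κ) : Fin 2 → ZMod 3 :=
    if h : j ∈ t then z ⟨j, h⟩ else 0
  let L : (t → Fin 2 → ZMod 3) →ₗ[ZMod 3] (s → Fin 2 → ZMod 3) :=
    LinearMap.pi fun i => ∑ j : t, (Matrix.mulVecLin (G i j)) ∘ₗ LinearMap.proj j
  have hL (z) (i : s) : L z i = ∑ j : t, G i j *ᵥ z j := by
    simp [L]
  have happ (z) (i : s) : L z i = app G (ext z) i := by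
    rw [hL, app, ← sum_subset (subset_univ t), ← sum_coe_sort t]
    · exact sum_congr rfl fun j _ => by simp [ext]
    · intro j _ hj
      simp [ext, hj]
  have hinj : Function.Injective L := by
    rw [injective_iff_map_eq_zero]
    intro z hz
    have h := hG.eq_zero (x := ext z) (s := t) (t := s) htc.le (fun j hj => by
      by_contra h
      exact hj (by simp [ext, h])) fun i hi => by
        rw [← happ z ⟨i, hi⟩, hz]
        rfl
    ext1 j
    simpa [ext] using congrFun h j
  have hsurj : Function.Surjective L := by
    refine (LinearMap.injective_iff_surjective_of_finrank_eq_finrank ?_).1 hinj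
    simp [Module.finrank_pi_fintype, htc]
  have hzero (w : s → Fin 2 → ZMod 3) : ∑ i : s, y i ⬝ᵥ w i = 0 := by
    obtain ⟨z, rfl⟩ := hsurj w
    simp only [hL, dotProduct_sum, Matrix.dotProduct_mulVec]
    rw [sum_comm]
    refine sum_eq_zero fun j _ => ?_
    rw [← sum_dotProduct]
    have hj : app (fun j i => (G i j)ᵀ) y j = 0 := (mem_filter.1 (ht j.2)).2
    simp only [app, Matrix.mulVec_transpose] at hj
    rw [← sum_subset (subset_univ s), ← sum_coe_sort s] at hj
    · rw [hj, zero_dotProduct]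
    · intro i _ hi
      have : y i = 0 := by simpa [hs] using hi
      simp [this]
  refine hy (funext fun i => ?_)
  by_contra hi
  have his : i ∈ s := by simpa [hs] using hi
  refine hi (dotProduct_eq_zero _ fun v => ?_)
  have h := hzero (Pi.single ⟨i, his⟩ v)
  rwa [Fintype.sum_eq_single ⟨i, his⟩ (fun j hj => by simp [hj]), Pi.single_eq_same] at h

/-- The **MDS conjecture** for superregular block matrices. -/
theorem Superregular.card_add_card_le {G : ι → κ → Mat} (hG : Superregular G)
    (hι : 2 ≤ Fintype.card ι) (hκ : 2 ≤ Fintype.card κ) :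
    Fintype.card ι + Fintype.card κ ≤ 10 := by
  by_cases h : 6 ≤ Fintype.card ι
  · exact hG.card_add_card_le_of_six_le h hκ
  by_cases h' : 6 ≤ Fintype.card κ
  · have := hG.transpose.card_add_card_le_of_six_le h' hι
    omega
  · omega

end Bound

/-! ### From codes to block matrices -/

/-- An additive MDS code over a nine element alphabet, split into information and check
coordinates, is the graph of a superregular block matrix. -/
theorem exists_superregular {k r : ℕ} {F : Type*} [AddCommGroup F] [Module (ZMod 3) F] [Fintype F]
    [DecidableEq F] (hF : Fintype.card F = 9) (C : Submodule (ZMod 3) (Fin (k + r) → F))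
    (hcard : Nat.card C = 9 ^ k) (hnorm : ∀ c ∈ C, c ≠ 0 → r + 1 ≤ hammingNorm c) :
    ∃ G : Fin r → Fin k → Mat, Superregular G := by
  classical
  have hrank : Module.finrank (ZMod 3) F = 2 := by
    have h := Module.card_eq_pow_finrank (K := ZMod 3) (V := F)
    rw [hF, ZMod.card] at h
    exact (Nat.pow_right_injective (le_refl 2 |>.trans (by norm_num : 2 ≤ 3))
      (h.symm.trans (by norm_num : 9 = 3 ^ 2)))
  let φ : F ≃ₗ[ZMod 3] (Fin 2 → ZMod 3) := LinearEquiv.ofFinrankEq _ _ (by simp [hrank])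
  have hsplit (c : Fin (k + r) → F) : hammingNorm c =
      #{j : Fin k | φ (c (Fin.castAdd r j)) ≠ 0} + #{i : Fin r | φ (c (Fin.natAdd k i)) ≠ 0} := by
    simp only [hammingNorm, card_filter, Fin.sum_univ_add, ne_eq,
      EmbeddingLike.map_eq_zero_iff]
  let π : C →ₗ[ZMod 3] (Fin k → Fin 2 → ZMod 3) :=
    LinearMap.pi fun j => φ.toLinearMap ∘ₗ LinearMap.proj (Fin.castAdd r j) ∘ₗ C.subtype
  have hπ (c : C) (j : Fin k) : π c j = φ (c.1 (Fin.castAdd r j)) := rfl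
  have hinj : Function.Injective π := by
    rw [injective_iff_map_eq_zero]
    intro c hc
    by_contra hne
    have h1 := hnorm c.1 c.2 (fun h => hne (Subtype.ext h))
    have h2 : #{i : Fin r | φ (c.1 (Fin.natAdd k i)) ≠ 0} ≤ r :=
      (card_filter_le _ _).trans (by simp)
    have h3 : #{j : Fin k | φ (c.1 (Fin.castAdd r j)) ≠ 0} = 0 := by
      rw [card_eq_zero, filter_eq_empty_iff]
      intro j _
      rw [← hπ, hc]
      simp
    rw [hsplit] at h1
    omega
  have hbij : Function.Bijective π := by
    refine (Nat.bijective_iff_injective_and_card π).2 ⟨hinj, ?_⟩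
    rw [hcard]
    simp [Nat.card_eq_fintype_card]
  let e := LinearEquiv.ofBijective π hbij
  let f : (Fin k → Fin 2 → ZMod 3) →ₗ[ZMod 3] (Fin r → Fin 2 → ZMod 3) :=
    (LinearMap.pi fun i => φ.toLinearMap ∘ₗ LinearMap.proj (Fin.natAdd k i) ∘ₗ C.subtype) ∘ₗ
      e.symm.toLinearMap
  refine ⟨fun i j => LinearMap.toMatrix'
    (LinearMap.proj i ∘ₗ f ∘ₗ LinearMap.single (ZMod 3) (fun _ => Fin 2 → ZMod 3) j),
    fun x hx => ?_⟩
  have happ (i : Fin r) : app (fun i j => LinearMap.toMatrix'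
      (LinearMap.proj i ∘ₗ f ∘ₗ LinearMap.single (ZMod 3) (fun _ => Fin 2 → ZMod 3) j)) x i =
        f x i := by
    simp only [app, LinearMap.toMatrix'_mulVec, LinearMap.comp_apply, LinearMap.proj_apply,
      LinearMap.coe_single]
    rw [← Finset.sum_apply, ← map_sum, univ_sum_single]
  have hf (i : Fin r) : f x i = φ ((e.symm x).1 (Fin.natAdd k i)) := rfl
  have he (j : Fin k) : φ ((e.symm x).1 (Fin.castAdd r j)) = x j := by
    rw [← hπ]
    exact congrFun (e.apply_symm_apply x) j
  have hne : (e.symm x).1 ≠ 0 := fun h => hx (e.symm.map_eq_zero_iff.1 (Subtype.ext h))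
  have h1 := hnorm _ (e.symm x).2 hne
  rw [hsplit] at h1
  simp only [he, ← hf] at h1
  have h2 := card_filter_add_card_filter_not (s := (univ : Finset (Fin r))) (fun i => f x i = 0)
  simp only [card_univ, Fintype.card_fin] at h2
  simp only [ne_eq] at h1
  simp only [happ, ne_eq]
  omega

end AdditiveMDS

/-- **The MDS conjecture for additive codes over `F₉`.**
If `C ⊆ F₉^n` is a nonempty subset closed under componentwise addition with `|C| = 9^k`,
`2 ≤ k ≤ n - 2`, and minimum Hamming distance `n - k + 1`, then `n ≤ 10`. -/
theorem MDS_conjecture_additive_codes_over_F9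
    (n k : ℕ) (hk2 : 2 ≤ k) (hkn : k ≤ n - 2)
    (F : Type*) [Field F] [Fintype F] [DecidableEq F] (hF : Fintype.card F = 9)
    (C : Set (Fin n → F)) (hne : C.Nonempty)
    (hadd : ∀ u ∈ C, ∀ v ∈ C, u + v ∈ C)
    (hcard : Nat.card C = 9 ^ k)
    (hdist : sInf {e : ℕ | ∃ u ∈ C, ∃ v ∈ C, u ≠ v ∧ hammingDist u v = e} = n - k + 1) :
    n ≤ 10 := by
  obtain ⟨r, rfl⟩ := Nat.exists_eq_add_of_le (hkn.trans (Nat.sub_le n 2))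
  have h3 : (3 : F) = 0 := by
    have h9 : ((9 : ℕ) : F) = 0 := hF ▸ FiniteField.cast_card_eq_zero F
    have : (3 : F) * 3 = 0 := by
      rw [← h9]
      norm_num
    exact mul_self_eq_zero.1 this
  have hthree (x : F) : 3 • x = 0 := by
    rw [nsmul_eq_mul, Nat.cast_ofNat, h3, zero_mul]
  have hthree' (x : Fin (k + r) → F) : 3 • x = 0 := funext fun i => hthree (x i)
  let := AddCommGroup.zmodModule hthree
  have hnsmul (m : ℕ) {u : Fin (k + r) → F} (hu : u ∈ C) : (m + 1) • u ∈ C := by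
    induction m with
    | zero => simpa using hu
    | succ m ih =>
      rw [succ_nsmul]
      exact hadd _ ih _ hu
  have hzero : (0 : Fin (k + r) → F) ∈ C := by
    obtain ⟨u, hu⟩ := hne
    exact hthree' u ▸ hnsmul 2 hu
  let S : AddSubgroup (Fin (k + r) → F) :=
    { carrier := C
      add_mem' := fun hu hv => hadd _ hu _ hv
      zero_mem' := hzero
      neg_mem' := fun {u} hu => by
        have h : -u = (1 + 1) • u := by
          rw [neg_eq_iff_add_eq_zero, ← succ_nsmul']
          exact hthree' u
        rw [h]
        exact hnsmul 1 hu }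
  obtain ⟨G, hG⟩ := AdditiveMDS.exists_superregular hF (AddSubgroup.toZModSubmodule 3 S) hcard
    fun c hc hc0 => by
      rw [← hammingDist_zero_right]
      have h : sInf {e : ℕ | ∃ u ∈ C, ∃ v ∈ C, u ≠ v ∧ hammingDist u v = e} ≤ hammingDist c 0 :=
        Nat.sInf_le ⟨c, hc, 0, hzero, hc0, rfl⟩
      omega
  have := hG.card_add_card_le (by rw [Fintype.card_fin]; omega) (by rwa [Fintype.card_fin])
  simp only [Fintype.card_fin] at this
  omega
end

section
/- Let e be a primitive element of F_9 satisfying e² = e + 1, and let C = { (x, y, z, x+y+z, x + e³y + y³ + e³z − e²z³, x + e³y − y³ + e³z + e²z³, x + ey − e²y³ + ez + z³, x + ey + e²y³ + ez − z³) : x, y, z ∈ F_9 } ⊆ F_9^8. Then C is closed under componentwise addition, has exactly 9³ = 729 elements (the defining map F_9³ → F_9^8 is injective), and every nonzero element of C has at most 2 zero coordinates; in other words, C is an (8, 9³, 6)_9 additive MDS code. -/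
/-- The word with entries `(aᵢ, bᵢ)`, standing for `aᵢ + bᵢ * e`, of the code generated by
`x = a + b * e`, `y = c + d * e` and `z = f + g * e`, where `e ^ 2 = e + 1` in characteristic `3`. -/
def codeCoords (a b c d f g : ZMod 3) : Fin 8 → ZMod 3 × ZMod 3 :=
  ![(a, b), (c, d), (f, g), (a + c + f, b + d + g),
    (a - c - g, b - c - d + f + g),
    (a + d - f - g, b - c + d - g),
    (a - c + d + f - g, b - d + f),
    (a + c + d - f, b - c + f - g)]

theorem card_zeros_codeCoords_le : ∀ a b c d f g : ZMod 3,
    (a, b, c, d, f, g) ≠ 0 →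
      (Finset.univ.filter fun j => codeCoords a b c d f g j = 0).card ≤ 2 := by
  decide +kernel

theorem three_eq_zero_of_card_eq_nine {F : Type*} [Field F] [Fintype F]
    (hF : Fintype.card F = 9) : (3 : F) = 0 := by
  have h := FiniteField.cast_card_eq_zero F
  rw [hF] at h
  have h' : (3 : F) * 3 = 0 := by
    norm_num
    exact_mod_cast h
  exact mul_self_eq_zero.mp h'

section Coordinates

variable {F : Type*} [Field F] (ι : ZMod 3 →+* F) {e : F}

theorem coord_add_mul_eq_zero_iff (he : e ^ 2 = e + 1) (a b : ZMod 3) :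
    ι a + ι b * e = 0 ↔ (a, b) = 0 := by
  constructor
  · intro h
    have hN : ι (a ^ 2 + a * b - b ^ 2) = 0 := by
      simp only [map_add, map_sub, map_mul, map_pow]
      linear_combination (ι a + ι b * (1 - e)) * h + ι b ^ 2 * he
    rw [map_eq_zero] at hN
    clear h
    revert a b
    decide
  · intro h
    obtain ⟨rfl, rfl⟩ := Prod.mk.inj h
    simp

theorem exists_coords [Fintype F] (hF : Fintype.card F = 9) (he : e ^ 2 = e + 1) (x : F) :
    ∃ a b : ZMod 3, ι a + ι b * e = x := by
  have hinj : Function.Injective (fun p : ZMod 3 × ZMod 3 => ι p.1 + ι p.2 * e) := by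
    intro p q h
    have h0 : ι (p.1 - q.1) + ι (p.2 - q.2) * e = 0 := by
      simp only [map_sub]
      linear_combination h
    exact sub_eq_zero.mp ((coord_add_mul_eq_zero_iff ι he _ _).mp h0)
  have hbij := (Fintype.bijective_iff_injective_and_card _).mpr
    ⟨hinj, by rw [hF, Fintype.card_prod, ZMod.card]⟩
  obtain ⟨p, hp⟩ := hbij.surjective x
  exact ⟨p.1, p.2, hp⟩

theorem coord_cube (h3 : (3 : F) = 0) (he : e ^ 2 = e + 1) (a b : ZMod 3) :
    (ι a + ι b * e) ^ 3 = ι a + ι b - ι b * e := by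
  have ha : ι a ^ 3 = ι a := by rw [← map_pow, ZMod.pow_card]
  have hb : ι b ^ 3 = ι b := by rw [← map_pow, ZMod.pow_card]
  linear_combination ha + e ^ 3 * hb + ι b * (e + 1) * he +
    (ι a ^ 2 * ι b * e + ι a * ι b ^ 2 * e ^ 2 + ι b * e) * h3

end Coordinates


/-- **An `(8, 9³, 6)₉` additive (non-linear) MDS code.**
Let `e` be a primitive element of `F₉` with `e² = e + 1` and let `C ⊆ F₉^8` be the code
`{(x, y, z, x+y+z, x+e³y+y³+e³z−e²z³, x+e³y−y³+e³z+e²z³, x+ey−e²y³+ez+z³, x+ey+e²y³+ez−z³)}`.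
Then `C` is closed under componentwise addition, the defining map is injective (so
`|C| = 9³ = 729`), and every nonzero codeword has at most `2` zero coordinates; i.e. `C` is an
`(8, 9³, 6)₉` additive MDS code. -/
theorem explicit_additive_MDS_code_8_729_6_over_F9
    (F : Type*) [Field F] [Fintype F] [DecidableEq F] (hF : Fintype.card F = 9)
    (e : F) (he : e ^ 2 = e + 1) (hprim : ∀ x : F, x ≠ 0 → ∃ m : ℕ, e ^ m = x)
    (C : Set (Fin 8 → F))
    (hC : C = {w : Fin 8 → F | ∃ x y z : F,
      w = ![x, y, z, x + y + z,
        x + e ^ 3 * y + y ^ 3 + e ^ 3 * z - e ^ 2 * z ^ 3,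
        x + e ^ 3 * y - y ^ 3 + e ^ 3 * z + e ^ 2 * z ^ 3,
        x + e * y - e ^ 2 * y ^ 3 + e * z + z ^ 3,
        x + e * y + e ^ 2 * y ^ 3 + e * z - z ^ 3]}) :
    (∀ u ∈ C, ∀ v ∈ C, u + v ∈ C) ∧
    Function.Injective (fun p : F × F × F =>
      ![p.1, p.2.1, p.2.2, p.1 + p.2.1 + p.2.2,
        p.1 + e ^ 3 * p.2.1 + p.2.1 ^ 3 + e ^ 3 * p.2.2 - e ^ 2 * p.2.2 ^ 3,
        p.1 + e ^ 3 * p.2.1 - p.2.1 ^ 3 + e ^ 3 * p.2.2 + e ^ 2 * p.2.2 ^ 3,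
        p.1 + e * p.2.1 - e ^ 2 * p.2.1 ^ 3 + e * p.2.2 + p.2.2 ^ 3,
        p.1 + e * p.2.1 + e ^ 2 * p.2.1 ^ 3 + e * p.2.2 - p.2.2 ^ 3]) ∧
    Nat.card C = 729 ∧
    ∀ u ∈ C, u ≠ 0 → (Finset.univ.filter fun j : Fin 8 => u j = 0).card ≤ 2 := by
  have h3 : (3 : F) = 0 := three_eq_zero_of_card_eq_nine hF
  have hcube (x y : F) : (x + y) ^ 3 = x ^ 3 + y ^ 3 := by
    linear_combination (x ^ 2 * y + x * y ^ 2) * h3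
  have hinj : Function.Injective (fun p : F × F × F =>
      ![p.1, p.2.1, p.2.2, p.1 + p.2.1 + p.2.2,
        p.1 + e ^ 3 * p.2.1 + p.2.1 ^ 3 + e ^ 3 * p.2.2 - e ^ 2 * p.2.2 ^ 3,
        p.1 + e ^ 3 * p.2.1 - p.2.1 ^ 3 + e ^ 3 * p.2.2 + e ^ 2 * p.2.2 ^ 3,
        p.1 + e * p.2.1 - e ^ 2 * p.2.1 ^ 3 + e * p.2.2 + p.2.2 ^ 3,
        p.1 + e * p.2.1 + e ^ 2 * p.2.1 ^ 3 + e * p.2.2 - p.2.2 ^ 3]) := by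
    intro p q h
    exact Prod.ext (congrFun h 0) (Prod.ext (congrFun h 1) (congrFun h 2))
  subst hC
  refine ⟨?_, hinj, ?_, ?_⟩
  · rintro _ ⟨x, y, z, rfl⟩ _ ⟨x', y', z', rfl⟩
    refine ⟨x + x', y + y', z + z', ?_⟩
    ext j
    fin_cases j <;> simp [hcube] <;> ring
  · have hcard := Nat.card_range_of_injective hinj
    rw [Nat.card_prod, Nat.card_prod, Nat.card_eq_fintype_card (α := F), hF] at hcard
    rw [← show 9 * (9 * 9) = 729 from rfl, ← hcard]
    congr 2
    ext w
    simp [eq_comm]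
  · rintro _ ⟨x, y, z, rfl⟩ hne
    have : CharP F 3 := (CharP.charP_iff_prime_eq_zero Nat.prime_three).mpr (by exact_mod_cast h3)
    let ι : ZMod 3 →+* F := ZMod.castHom dvd_rfl F
    obtain ⟨a, b, rfl⟩ := exists_coords ι hF he x
    obtain ⟨c, d, rfl⟩ := exists_coords ι hF he y
    obtain ⟨f, g, rfl⟩ := exists_coords ι hF he z
    have he3 : e ^ 3 = 1 - e := by linear_combination (e + 1) * he + e * h3
    simp only [coord_cube ι h3 he, he3, he] at hne ⊢
    set u : Fin 8 → F := ![_, _, _, _, _, _, _, _] with hu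
    have hcoord (j : Fin 8) :
        u j = ι (codeCoords a b c d f g j).1 + ι (codeCoords a b c d f g j).2 * e := by
      fin_cases j <;> simp [hu, codeCoords] <;> grind
    have hzero (j : Fin 8) : u j = 0 ↔ codeCoords a b c d f g j = 0 := by
      rw [hcoord, coord_add_mul_eq_zero_iff ι he]
    simp only [hzero]
    refine card_zeros_codeCoords_le a b c d f g fun h => hne ?_
    simp only [Prod.mk_eq_zero] at h
    obtain ⟨rfl, rfl, rfl, rfl, rfl, rfl⟩ := h
    ext j
    fin_cases j <;> simp [hu]
end

section
/- Let e be a primitive element of F_9 satisfying e² = e + 1, let C = { (x, y, z, x+y+z, x + e³y + y³ + e³z − e²z³, x + e³y − y³ + e³z + e²z³, x + ey − e²y³ + ez + z³, x + ey + e²y³ + ez − z³) : x, y, z ∈ F_9 } ⊆ F_9^8, and let γ be any nonzero element of F_9 with γ³ = −γ. Then C is contained in its dual with respect to the alternating trace form: for all u, v ∈ C, Tr_{F_9/F_3}( γ ( Σ_{i=1}^{8} u_i v_i³ − Σ_{i=1}^{8} u_i³ v_i ) ) = 0. -/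
/-- **The `(8, 9³, 6)₉` code is self-orthogonal for the alternating trace form.**
Let `e` be a primitive element of `F₉` with `e² = e + 1`, let `C ⊆ F₉^8` be the explicit
`(8, 9³, 6)₉` additive MDS code, and let `γ ≠ 0` satisfy `γ³ = −γ`.  Then `C ≤ C^{⊥ₐ}`:
for all `u, v ∈ C`, `Tr_{F₉/F₃}(γ(u·v³ − u³·v)) = 0`, where `Tr_{F₉/F₃}(x) = x + x³`. -/
theorem explicit_code_contained_in_alternating_dual
    (F : Type*) [Field F] [Fintype F] (hF : Fintype.card F = 9)
    (e : F) (he : e ^ 2 = e + 1) (hprim : ∀ x : F, x ≠ 0 → ∃ m : ℕ, e ^ m = x)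
    (C : Set (Fin 8 → F))
    (hC : C = {w : Fin 8 → F | ∃ x y z : F,
      w = ![x, y, z, x + y + z,
        x + e ^ 3 * y + y ^ 3 + e ^ 3 * z - e ^ 2 * z ^ 3,
        x + e ^ 3 * y - y ^ 3 + e ^ 3 * z + e ^ 2 * z ^ 3,
        x + e * y - e ^ 2 * y ^ 3 + e * z + z ^ 3,
        x + e * y + e ^ 2 * y ^ 3 + e * z - z ^ 3]})
    (γ : F) (hγ0 : γ ≠ 0) (hγ : γ ^ 3 = -γ) :
    ∀ u ∈ C, ∀ v ∈ C,
      γ * ((∑ i, u i * v i ^ 3) - ∑ i, u i ^ 3 * v i) +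
        (γ * ((∑ i, u i * v i ^ 3) - ∑ i, u i ^ 3 * v i)) ^ 3 = 0 := by
  have h3 : (3 : F) = 0 := by
    have h9 : ((9 : ℕ) : F) = 0 := hF ▸ Nat.cast_card_eq_zero F
    have h : (3 : F) ^ 2 = 0 := by
      rw [← h9]
      norm_num
    exact pow_eq_zero_iff two_ne_zero |>.mp h
  have frob : ∀ x : F, (x ^ 3) ^ 3 = x := fun x => by
    have h := FiniteField.pow_card x
    rw [hF] at h
    rw [← pow_mul, h]
  have add_cube : ∀ a b : F, (a + b) ^ 3 = a ^ 3 + b ^ 3 := fun a b => by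
    linear_combination (a ^ 2 * b + a * b ^ 2) * h3
  have sub_cube : ∀ a b : F, (a - b) ^ 3 = a ^ 3 - b ^ 3 := fun a b => by
    linear_combination (a * b ^ 2 - a ^ 2 * b) * h3
  have he3 : e ^ 3 = 1 - e := by
    linear_combination (e + 1) * he + e * h3
  subst hC
  rintro _ ⟨x, y, z, rfl⟩ _ ⟨x', y', z', rfl⟩
  have hform : ∀ S : F, S = 0 → γ * S + (γ * S) ^ 3 = 0 := by
    rintro _ rfl
    simp
  apply hform
  simp only [Fin.sum_univ_eight, Matrix.cons_val]
  simp only [add_cube, sub_cube, mul_pow, frob, he3, he, one_pow]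
  generalize x ^ 3 = X, y ^ 3 = Y, z ^ 3 = Z, x' ^ 3 = X', y' ^ 3 = Y', z' ^ 3 = Z'
  grind
end

section
/- Let G be the 9 × 18 matrix over F_2 whose rows are: (1,0,0,0,0,0,0,0,0,1,0,0,1,0,0,1,0,0), (0,1,0,0,0,0,0,0,0,0,1,0,0,1,0,0,1,0), (0,0,1,0,0,0,0,0,0,0,0,1,0,0,1,0,0,1), (0,0,0,1,0,0,0,0,0,1,0,0,1,1,1,1,1,0), (0,0,0,0,1,0,0,0,0,0,1,0,1,0,0,0,1,1), (0,0,0,0,0,1,0,0,0,0,0,1,1,1,0,1,0,0), (0,0,0,0,0,0,1,0,0,1,0,0,0,1,0,0,1,1), (0,0,0,0,0,0,0,1,0,0,1,0,0,1,1,1,1,1), (0,0,0,0,0,0,0,0,1,0,0,1,1,0,1,0,1,0). Group the 18 coordinates into 6 consecutive blocks of 3 (identifying F_2³ with the alphabet F_8), and let C ⊆ (F_2³)^6 be the set of row-span vectors a·G for a ∈ F_2^9. Then the rows of G are linearly independent over F_2 (so |C| = 2^9 = 8³) and every nonzero codeword of C has at least 4 nonzero blocks; that is, C is a (6, 8³,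 4)_8 additive MDS code. -/
/-- The explicit `9 × 18` binary generator matrix of the `(6, 8³, 4)₈` additive MDS code. -/
def genMatrix689 : Matrix (Fin 9) (Fin 18) (ZMod 2) :=
  !![1,0,0,0,0,0,0,0,0,1,0,0,1,0,0,1,0,0;
     0,1,0,0,0,0,0,0,0,0,1,0,0,1,0,0,1,0;
     0,0,1,0,0,0,0,0,0,0,0,1,0,0,1,0,0,1;
     0,0,0,1,0,0,0,0,0,1,0,0,1,1,1,1,1,0;
     0,0,0,0,1,0,0,0,0,0,1,0,1,0,0,0,1,1;
     0,0,0,0,0,1,0,0,0,0,0,1,1,1,0,1,0,0;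
     0,0,0,0,0,0,1,0,0,1,0,0,0,1,0,0,1,1;
     0,0,0,0,0,0,0,1,0,0,1,0,0,1,1,1,1,1;
     0,0,0,0,0,0,0,0,1,0,0,1,1,0,1,0,1,0]

/-- The generator matrix is systematic: the first nine coordinates of a codeword are its message. -/
theorem vecMul_genMatrix689_castLE (a : Fin 9 → ZMod 2) (i : Fin 9) :
    Matrix.vecMul a genMatrix689 (Fin.castLE (by omega) i) = a i := by
  have h : ∀ k i : Fin 9, genMatrix689 k (Fin.castLE (by omega) i) = if k = i then 1 else 0 := by
    decide
  simp [Matrix.vecMul, dotProduct, h]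

theorem vecMul_genMatrix689_injective :
    Function.Injective fun a : Fin 9 → ZMod 2 => Matrix.vecMul a genMatrix689 := fun a a' h =>
  funext fun i => by
    rw [← vecMul_genMatrix689_castLE a, ← vecMul_genMatrix689_castLE a']
    exact congrFun h _

/-- The codeword of the message `a`, cut into six blocks of three coordinates. -/
def codeword689 (a : Fin 9 → ZMod 2) : Fin 6 → Fin 3 → ZMod 2 :=
  fun b t => Matrix.vecMul a genMatrix689 (finProdFinEquiv (b, t))

theorem codeword689_injective : Function.Injective codeword689 := fun a a' h =>
  vecMul_genMatrix689_injective <| funext fun j => by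
    obtain ⟨⟨b, t⟩, rfl⟩ := (finProdFinEquiv (m := 6) (n := 3)).surjective j
    exact congrFun (congrFun h b) t

theorem four_le_weight_codeword689 :
    ∀ a : Fin 9 → ZMod 2, a ≠ 0 →
      4 ≤ (Finset.univ.filter fun b : Fin 6 => codeword689 a b ≠ 0).card := by
  decide +kernel

/-- **The unique `(6, 8³, 4)₈` additive non-linear MDS code.**
Grouping the `18` binary coordinates into `6` blocks of `3` (identifying `F₂³` with `F₈`), the
row space `C` of the matrix `genMatrix689` over `F₂` has `F₂`-linearly independent generating
rows (so `|C| = 2⁹ = 8³`) and every nonzero codeword has at least `4` nonzero blocks; i.e. `C`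
is a `(6, 8³, 4)₈` additive MDS code. -/
theorem explicit_additive_MDS_code_6_512_4_over_F8
    (C : Set (Fin 6 → (Fin 3 → ZMod 2)))
    (hC : C = {w : Fin 6 → (Fin 3 → ZMod 2) | ∃ a : Fin 9 → ZMod 2,
      w = fun b t => Matrix.vecMul a genMatrix689 ⟨3 * b.1 + t.1, by omega⟩}) :
    LinearIndependent (ZMod 2) (fun i => genMatrix689 i) ∧
    Nat.card C = 512 ∧
    ∀ c ∈ C, c ≠ 0 →
      4 ≤ (Finset.univ.filter fun b : Fin 6 => c b ≠ 0).card := by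
  have hrange : C = Set.range codeword689 := by
    rw [hC]
    ext w
    refine exists_congr fun a => ?_
    rw [eq_comm]
    refine Eq.congr_left ?_
    funext b t
    exact congrArg (Matrix.vecMul a genMatrix689) (Fin.ext (add_comm _ _))
  refine ⟨Matrix.vecMul_injective_iff.1 vecMul_genMatrix689_injective, ?_, ?_⟩
  · rw [hrange, Nat.card_range_of_injective codeword689_injective]
    simp
  · rw [hrange]
    rintro _ ⟨a, rfl⟩ hne
    refine four_le_weight_codeword689 a fun ha => hne ?_
    subst ha
    ext b t
    simp [codeword689]
end

section
/- Let θ be a primitive element of F_16 satisfying θ⁴ = θ + 1, and let C ⊆ F_16^{11} be the set of vectors (x, y, z, x+y+z, x + θ¹²y + θ⁴y⁴ + θz + θ¹²z⁴, x + θ²y + θ⁷y⁴ + z + θ⁷z⁴, x + θ⁴y⁴ + θ²z + θ⁴z⁴, x + θ¹⁴y + θ⁷y⁴ + θ¹²z + θ⁴z⁴, x + θy + θ⁹y⁴ + θ¹⁴z + θ⁷z⁴, x + θ²y⁴ + z + θ¹⁴z⁴, x + θ¹⁴y + θ⁴y⁴ + θ¹²z + θ⁷z⁴) for x, y, z ∈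 F_16. Then C is an F_4-subspace of F_16^{11} (F_4 being the subfield of order 4 of F_16), |C| = 16³ (the defining map F_16³ → F_16^{11} is injective), and every nonzero element of C has at most 2 zero coordinates; in other words, C is an (11, 16³, 9)_{16} additive MDS code linear over F_4. -/
/-- Coordinates of an element of `F₁₆` in the basis `1, θ, θ², θ³` over `F₂`. -/
abbrev Nibble : Type := Bool × Bool × Bool × Bool

namespace Nibble

/-- Addition of coordinate vectors. -/
def add (a b : Nibble) : Nibble :=
  (a.1 ^^ b.1, a.2.1 ^^ b.2.1, a.2.2.1 ^^ b.2.2.1, a.2.2.2 ^^ b.2.2.2)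

/-- The zero coordinate vector. -/
def zero : Nibble := (false, false, false, false)

/-- Multiplication by `θ` in coordinates. -/
def mulTheta (a : Nibble) : Nibble :=
  (a.2.2.2, a.1 ^^ a.2.2.2, a.2.1, a.2.2.1)

/-- The map `x ↦ x ^ 4` in coordinates. -/
def powFour (a : Nibble) : Nibble :=
  (a.1 ^^ a.2.1 ^^ a.2.2.1 ^^ a.2.2.2, a.2.1 ^^ a.2.2.2, a.2.2.1 ^^ a.2.2.2, a.2.2.2)

/-- The codeword attached to `(x, y, z)`, in coordinates. -/
def codeword (x y z : Nibble) : List.Vector Nibble 11 :=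
  let s := mulTheta
  let y' := powFour y
  let z' := powFour z
  ⟨[x, y, z, add (add x y) z,
    add (add (add (add x (s^[12] y)) (s^[4] y')) (s z)) (s^[12] z'),
    add (add (add (add x (s^[2] y)) (s^[7] y')) z) (s^[7] z'),
    add (add (add x (s^[4] y')) (s^[2] z)) (s^[4] z'),
    add (add (add (add x (s^[14] y)) (s^[7] y')) (s^[12] z)) (s^[4] z'),
    add (add (add (add x (s y)) (s^[9] y')) (s^[14] z)) (s^[7] z'),
    add (add (add x (s^[2] y')) z) (s^[14] z'),
    add (add (add (add x (s^[14] y)) (s^[4] y')) (s^[12] z)) (s^[7] z')], rfl⟩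

set_option synthInstance.maxSize 10000 in
set_option synthInstance.maxHeartbeats 400000 in
theorem count_zero_codeword_le (x y z : Nibble) :
    x = zero ∧ y = zero ∧ z = zero ∨ (codeword x y z).toList.count zero ≤ 2 := by
  revert x y z
  decide +kernel

theorem card_zeros_codeword_le (x y z : Nibble) (h : ¬(x = zero ∧ y = zero ∧ z = zero)) :
    (Finset.univ.filter fun j => (codeword x y z).get j = zero).card ≤ 2 := by
  rw [Fin.card_filter_univ_eq_vector_get_eq_count,
    lawful_beq_subsingleton instBEqOfDecidableEq instBEqProd]
  exact (count_zero_codeword_le x y z).resolve_left h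

section ToField

variable {F : Type*} [Field F] (θ : F)

/-- The element of the field with the given coordinates. -/
def toField (a : Nibble) : F :=
  (bif a.1 then 1 else 0) + (bif a.2.1 then 1 else 0) * θ +
    (bif a.2.2.1 then 1 else 0) * θ ^ 2 + (bif a.2.2.2 then 1 else 0) * θ ^ 3

theorem toField_zero : toField θ zero = 0 := by simp [toField, zero]

variable [CharP F 2]

theorem cond_xor (s t : Bool) : (bif s ^^ t then (1 : F) else 0) =
    (bif s then 1 else 0) + (bif t then 1 else 0) := by
  cases s <;> cases t <;> simp [CharTwo.add_self_eq_zero]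

theorem toField_add (a b : Nibble) : toField θ (add a b) = toField θ a + toField θ b := by
  simp only [toField, add, cond_xor]
  ring

theorem add_pow_four (a b : F) : (a + b) ^ 4 = a ^ 4 + b ^ 4 := by
  simpa using add_pow_char_pow a b (p := 2) (n := 2)

variable {θ}

theorem toField_mulTheta (hθ : θ ^ 4 = θ + 1) (a : Nibble) :
    toField θ (mulTheta a) = θ * toField θ a := by
  simp only [toField, mulTheta, cond_xor]
  linear_combination -(bif a.2.2.2 then (1 : F) else 0) * hθ

theorem toField_iterate_mulTheta (hθ : θ ^ 4 = θ + 1) (n : ℕ) (a : Nibble) :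
    toField θ (mulTheta^[n] a) = θ ^ n * toField θ a := by
  induction n with
  | zero => simp
  | succ n ih => rw [Function.iterate_succ_apply', toField_mulTheta hθ, ih]; ring

theorem toField_powFour (hθ : θ ^ 4 = θ + 1) (a : Nibble) :
    toField θ (powFour a) = toField θ a ^ 4 := by
  have h4 (s : Bool) : (bif s then (1 : F) else 0) ^ 4 = bif s then 1 else 0 := by
    cases s <;> simp
  have h2 : (2 : F) = 0 := CharTwo.two_eq_zero
  have hθ2 : (θ ^ 2) ^ 4 = θ ^ 2 + 1 := by
    linear_combination (θ ^ 4 + θ + 1) * hθ + θ * h2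
  have hθ3 : (θ ^ 3) ^ 4 = θ ^ 3 + θ ^ 2 + θ + 1 := by
    linear_combination (θ ^ 8 + θ ^ 4 * (θ + 1) + (θ + 1) ^ 2) * hθ + (θ ^ 2 + θ) * h2
  simp only [toField, powFour, cond_xor, add_pow_four, mul_pow, h4, hθ, hθ2, hθ3]
  ring

theorem toField_codeword (hθ : θ ^ 4 = θ + 1) (x y z : Nibble) :
    (fun j => toField θ ((codeword x y z).get j)) =
      ![toField θ x, toField θ y, toField θ z, toField θ x + toField θ y + toField θ z,
        toField θ x + θ ^ 12 * toField θ y + θ ^ 4 * toField θ y ^ 4 + θ * toField θ z +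
          θ ^ 12 * toField θ z ^ 4,
        toField θ x + θ ^ 2 * toField θ y + θ ^ 7 * toField θ y ^ 4 + toField θ z +
          θ ^ 7 * toField θ z ^ 4,
        toField θ x + θ ^ 4 * toField θ y ^ 4 + θ ^ 2 * toField θ z + θ ^ 4 * toField θ z ^ 4,
        toField θ x + θ ^ 14 * toField θ y + θ ^ 7 * toField θ y ^ 4 + θ ^ 12 * toField θ z +
          θ ^ 4 * toField θ z ^ 4,
        toField θ x + θ * toField θ y + θ ^ 9 * toField θ y ^ 4 + θ ^ 14 * toField θ z +
          θ ^ 7 * toField θ z ^ 4,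
        toField θ x + θ ^ 2 * toField θ y ^ 4 + toField θ z + θ ^ 14 * toField θ z ^ 4,
        toField θ x + θ ^ 14 * toField θ y + θ ^ 4 * toField θ y ^ 4 + θ ^ 12 * toField θ z +
          θ ^ 7 * toField θ z ^ 4] := by
  funext j
  fin_cases j <;>
    simp [codeword, List.Vector.get, toField_add, toField_iterate_mulTheta hθ,
      toField_mulTheta hθ, toField_powFour hθ, -Function.iterate_succ]

theorem toField_surjective (hθ : θ ^ 4 = θ + 1) (hprim : ∀ x : F, x ≠ 0 → ∃ m : ℕ, θ ^ m = x) :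
    Function.Surjective (toField θ) := by
  intro x
  by_cases hx : x = 0
  · exact ⟨zero, by rw [toField_zero, hx]⟩
  · obtain ⟨m, rfl⟩ := hprim x hx
    refine ⟨mulTheta^[m] (true, false, false, false), ?_⟩
    rw [toField_iterate_mulTheta hθ]
    simp [toField]

theorem toField_bijective (hθ : θ ^ 4 = θ + 1) [Fintype F] (hF : Fintype.card F = 16)
    (hprim : ∀ x : F, x ≠ 0 → ∃ m : ℕ, θ ^ m = x) : Function.Bijective (toField θ) :=
  (Fintype.bijective_iff_surjective_and_card _).2
    ⟨toField_surjective hθ hprim, by rw [hF]; rfl⟩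

end ToField

end Nibble

/-- **An `(11, 16³, 9)₁₆` additive MDS code linear over `F₄`.**
Let `θ` be a primitive element of `F₁₆` with `θ⁴ = θ + 1` and let `C ⊆ F₁₆^11` be the explicit
code of the statement.  Then `C` is an `F₄`-subspace of `F₁₆^11` (closed under addition and
under multiplication by the elements `c` of the subfield `F₄ = {c | c⁴ = c}`), the defining
map is injective (so `|C| = 16³`), and every nonzero codeword has at most `2` zero
coordinates; i.e. `C` is an `(11, 16³, 9)₁₆` additive MDS code linear over `F₄`. -/
theorem explicit_additive_MDS_code_11_4096_9_over_F16
    (F : Type*) [Field F] [Fintype F] [DecidableEq F] (hF : Fintype.card F = 16)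
    (θ : F) (hθ : θ ^ 4 = θ + 1) (hprim : ∀ x : F, x ≠ 0 → ∃ m : ℕ, θ ^ m = x)
    (C : Set (Fin 11 → F))
    (hC : C = {w : Fin 11 → F | ∃ x y z : F,
      w = ![x, y, z, x + y + z,
        x + θ ^ 12 * y + θ ^ 4 * y ^ 4 + θ * z + θ ^ 12 * z ^ 4,
        x + θ ^ 2 * y + θ ^ 7 * y ^ 4 + z + θ ^ 7 * z ^ 4,
        x + θ ^ 4 * y ^ 4 + θ ^ 2 * z + θ ^ 4 * z ^ 4,
        x + θ ^ 14 * y + θ ^ 7 * y ^ 4 + θ ^ 12 * z + θ ^ 4 * z ^ 4,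
        x + θ * y + θ ^ 9 * y ^ 4 + θ ^ 14 * z + θ ^ 7 * z ^ 4,
        x + θ ^ 2 * y ^ 4 + z + θ ^ 14 * z ^ 4,
        x + θ ^ 14 * y + θ ^ 4 * y ^ 4 + θ ^ 12 * z + θ ^ 7 * z ^ 4]}) :
    (∀ u ∈ C, ∀ v ∈ C, u + v ∈ C) ∧
    (∀ c : F, c ^ 4 = c → ∀ u ∈ C, c • u ∈ C) ∧
    Function.Injective (fun p : F × F × F =>
      ![p.1, p.2.1, p.2.2, p.1 + p.2.1 + p.2.2,
        p.1 + θ ^ 12 * p.2.1 + θ ^ 4 * p.2.1 ^ 4 + θ * p.2.2 + θ ^ 12 * p.2.2 ^ 4,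
        p.1 + θ ^ 2 * p.2.1 + θ ^ 7 * p.2.1 ^ 4 + p.2.2 + θ ^ 7 * p.2.2 ^ 4,
        p.1 + θ ^ 4 * p.2.1 ^ 4 + θ ^ 2 * p.2.2 + θ ^ 4 * p.2.2 ^ 4,
        p.1 + θ ^ 14 * p.2.1 + θ ^ 7 * p.2.1 ^ 4 + θ ^ 12 * p.2.2 + θ ^ 4 * p.2.2 ^ 4,
        p.1 + θ * p.2.1 + θ ^ 9 * p.2.1 ^ 4 + θ ^ 14 * p.2.2 + θ ^ 7 * p.2.2 ^ 4,
        p.1 + θ ^ 2 * p.2.1 ^ 4 + p.2.2 + θ ^ 14 * p.2.2 ^ 4,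
        p.1 + θ ^ 14 * p.2.1 + θ ^ 4 * p.2.1 ^ 4 + θ ^ 12 * p.2.2 + θ ^ 7 * p.2.2 ^ 4]) ∧
    Nat.card C = 16 ^ 3 ∧
    ∀ u ∈ C, u ≠ 0 → (Finset.univ.filter fun j : Fin 11 => u j = 0).card ≤ 2 := by
  have h2 : (2 : F) = 0 := by
    have h : ((Fintype.card F : ℕ) : F) = 0 := Nat.cast_card_eq_zero F
    rw [hF] at h
    exact pow_eq_zero_iff (n := 4) (by decide) |>.1 (by norm_num at h ⊢; exact h)
  have : CharP F 2 := CharTwo.of_one_ne_zero_of_two_eq_zero one_ne_zero h2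
  subst hC
  have hinj : Function.Injective (fun p : F × F × F =>
      ![p.1, p.2.1, p.2.2, p.1 + p.2.1 + p.2.2,
        p.1 + θ ^ 12 * p.2.1 + θ ^ 4 * p.2.1 ^ 4 + θ * p.2.2 + θ ^ 12 * p.2.2 ^ 4,
        p.1 + θ ^ 2 * p.2.1 + θ ^ 7 * p.2.1 ^ 4 + p.2.2 + θ ^ 7 * p.2.2 ^ 4,
        p.1 + θ ^ 4 * p.2.1 ^ 4 + θ ^ 2 * p.2.2 + θ ^ 4 * p.2.2 ^ 4,
        p.1 + θ ^ 14 * p.2.1 + θ ^ 7 * p.2.1 ^ 4 + θ ^ 12 * p.2.2 + θ ^ 4 * p.2.2 ^ 4,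
        p.1 + θ * p.2.1 + θ ^ 9 * p.2.1 ^ 4 + θ ^ 14 * p.2.2 + θ ^ 7 * p.2.2 ^ 4,
        p.1 + θ ^ 2 * p.2.1 ^ 4 + p.2.2 + θ ^ 14 * p.2.2 ^ 4,
        p.1 + θ ^ 14 * p.2.1 + θ ^ 4 * p.2.1 ^ 4 + θ ^ 12 * p.2.2 + θ ^ 7 * p.2.2 ^ 4]) :=
    fun p q h => Prod.ext (congrFun h 0) (Prod.ext (congrFun h 1) (congrFun h 2))
  refine ⟨?_, ?_, hinj, ?_, ?_⟩
  · rintro _ ⟨x, y, z, rfl⟩ _ ⟨x', y', z', rfl⟩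
    refine ⟨x + x', y + y', z + z', ?_⟩
    simp only [Nibble.add_pow_four, Matrix.cons_add_cons, Matrix.empty_add_empty]
    congr! 1
    ring_nf
  · rintro c hc _ ⟨x, y, z, rfl⟩
    refine ⟨c * x, c * y, c * z, ?_⟩
    simp only [mul_pow, hc, Matrix.smul_cons, Matrix.smul_empty, smul_eq_mul]
    ring_nf
  · have hcard := Nat.card_range_of_injective hinj
    rw [Nat.card_prod, Nat.card_prod, Nat.card_eq_fintype_card (α := F), hF] at hcard
    convert hcard using 3
    swap
    · norm_num
    ext w
    simp [eq_comm]
  · rintro _ ⟨x, y, z, rfl⟩ hu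
    have hbij := Nibble.toField_bijective hθ hF hprim
    obtain ⟨a, rfl⟩ := hbij.surjective x
    obtain ⟨b, rfl⟩ := hbij.surjective y
    obtain ⟨c, rfl⟩ := hbij.surjective z
    rw [← Nibble.toField_codeword hθ] at hu ⊢
    have hzero (n : Nibble) : Nibble.toField θ n = 0 ↔ n = Nibble.zero := by
      rw [← Nibble.toField_zero θ, hbij.injective.eq_iff]
    simp only [hzero]
    refine Nibble.card_zeros_codeword_le a b c ?_
    rintro ⟨rfl, rfl, rfl⟩
    refine hu (funext fun j => ?_)
    rw [Pi.zero_apply, hzero]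
    revert j
    decide
end
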